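/- arXiv:2103.04231 — 3 statements merged into one kernel-verified Lean document; each statement's English description precedes it below -/
import Mathlib

section
/- For every integer m ≥ 1 and all reals θ > 0 and a > −1, the average quantum purity over the quantum interpolating ensemble is E_f[Σ_{i=1}^m λ_i²] = Σ_{k=0}^{m−1} (−1)^{k+m−1} θ (θk+a+2)² A_θ(k) / (2 d (d+1) (m−1−k)! k!), where A_θ(k) = Γ(k+2(a+2)/θ) Γ(k+m+2(a+1)/θ) Γ(k+1+2/θ) / (Γ(k+2(a+1)/θ) Γ(k+m+2(a+2)/θ) Γ(k+1+2/θ−m)). -/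
open Finset MeasureTheory Set

noncomputable section

/-- The unconstrained interpolating weight on `[0,∞)^m`:
`h̃(x) = ∏_{i<j} ((x_i−x_j)/(x_i+x_j))·(x_i^θ−x_j^θ) · ∏_i x_i^a e^{−x_i}`. -/
def hWeight (m : ℕ) (θ a : ℝ) (x : Fin m → ℝ) : ℝ :=
  (∏ p ∈ Finset.univ.filter (fun p : Fin m × Fin m => p.1 < p.2),
      ((x p.1 - x p.2) / (x p.1 + x p.2) * (x p.1 ^ θ - x p.2 ^ θ)))
    * ∏ i, x i ^ a * Real.exp (-(x i))

/-- The positive orthant `[0,∞)^m`. -/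
def orthant (m : ℕ) : Set (Fin m → ℝ) := {x | ∀ i, 0 ≤ x i}

/-- The unconstrained average
`E_h[G] = (∫_{[0,∞)^m} G h̃)/(∫_{[0,∞)^m} h̃)`. -/
def Eh (m : ℕ) (θ a : ℝ) (G : (Fin m → ℝ) → ℝ) : ℝ :=
  (∫ x in orthant m, G x * hWeight m θ a x) / (∫ x in orthant m, hWeight m θ a x)

/-- The density (up to normalization) of the quantum interpolating ensemble:
`Ṽ(λ) = ∏_{i<j} ((λ_i−λ_j)/(λ_i+λ_j))·(λ_i^θ−λ_j^θ) · ∏_i λ_i^a`. -/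
def Vdens (m : ℕ) (θ a : ℝ) (lam : Fin m → ℝ) : ℝ :=
  (∏ p ∈ Finset.univ.filter (fun p : Fin m × Fin m => p.1 < p.2),
      ((lam p.1 - lam p.2) / (lam p.1 + lam p.2) * (lam p.1 ^ θ - lam p.2 ^ θ)))
    * ∏ i, lam i ^ a

/-- Parametrization of the probability simplex: the first `m−1` coordinates
are free and the last one is `1 −` their sum. -/
def simplexExt (m : ℕ) (lam : Fin (m - 1) → ℝ) : Fin m → ℝ :=
  fun i => if h : (i : ℕ) < m - 1 then lam ⟨i, h⟩ else 1 - ∑ j, lam j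

/-- The parameter domain `Δ = {λ ∈ [0,∞)^{m−1} : Σ λ_i ≤ 1}` of the simplex. -/
def simplexDom (m : ℕ) : Set (Fin (m - 1) → ℝ) :=
  {lam | (∀ i, 0 ≤ lam i) ∧ ∑ i, lam i ≤ 1}

/-- The constrained average over the quantum interpolating ensemble:
`E_f[G] = (∫_Δ G(λ) Ṽ(λ) dλ)/(∫_Δ Ṽ(λ) dλ)`, where `λ` runs over the simplex
parametrized by its first `m−1` coordinates. -/
def Ef (m : ℕ) (θ a : ℝ) (G : (Fin m → ℝ) → ℝ) : ℝ :=
  (∫ l in simplexDom m, G (simplexExt m l) * Vdens m θ a (simplexExt m l))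
    / (∫ l in simplexDom m, Vdens m θ a (simplexExt m l))

/-- The parameter `d = m(mθ − θ + 2a + 2)/2`. -/
def dPar (m : ℕ) (θ a : ℝ) : ℝ := m * (m * θ - θ + 2 * a + 2) / 2

/-- The digamma function `ψ₀ = Γ'/Γ`. -/
def psi0 (x : ℝ) : ℝ := deriv Real.Gamma x / Real.Gamma x

open scoped ENNReal

lemma measurableSet_orthant (m : ℕ) : MeasurableSet (orthant m) := by
  have : orthant m = ⋂ i, {x | 0 ≤ x i} := by ext; simp [orthant]
  rw [this]
  exact MeasurableSet.iInter fun i => measurableSet_le measurable_const (measurable_pi_apply i)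

lemma measurableSet_simplexDom (m : ℕ) : MeasurableSet (simplexDom m) := by
  have : simplexDom m = (⋂ i, {x | 0 ≤ x i}) ∩ {x | ∑ i, x i ≤ 1} := by
    ext; simp [simplexDom]
  rw [this]
  refine MeasurableSet.inter
    (MeasurableSet.iInter fun i => measurableSet_le measurable_const (measurable_pi_apply i)) ?_
  exact measurableSet_le (by fun_prop) measurable_const

lemma simplexExt_succ (n : ℕ) (l : Fin n → ℝ) :
    simplexExt (n + 1) l = Fin.snoc (α := fun _ => ℝ) l (1 - ∑ j, l j) := by
  funext i
  simp only [simplexExt, Fin.snoc]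
  rfl

lemma measurable_simplexExt_succ (n : ℕ) :
    Measurable (fun l : Fin n → ℝ => simplexExt (n + 1) l) := by
  refine measurable_pi_lambda _ fun i => ?_
  simp only [simplexExt]
  split_ifs
  · exact measurable_pi_apply _
  · exact Measurable.const_sub (Finset.measurable_sum _ fun i _ => measurable_pi_apply i) 1

lemma simplexExt_mem_orthant_iff (n : ℕ) (l : Fin n → ℝ) :
    simplexExt (n + 1) l ∈ orthant (n + 1) ↔ l ∈ simplexDom (n + 1) := by
  rw [simplexExt_succ]
  simp [orthant, simplexDom, Fin.forall_fin_succ']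

lemma lintegral_fin_succ_snoc (n : ℕ) (f : (Fin (n + 1) → ℝ) → ℝ≥0∞) (hf : Measurable f) :
    ∫⁻ x, f x = ∫⁻ l : Fin n → ℝ, ∫⁻ t : ℝ, f (Fin.snoc (α := fun _ => ℝ) l t) := by
  rw [← ((volume_preserving_piFinSuccAbove (fun _ : Fin (n + 1) => ℝ)
    (Fin.last n)).symm).lintegral_comp hf, Measure.volume_eq_prod, lintegral_prod_symm]
  · simp only [MeasurableEquiv.piFinSuccAbove_symm_apply, Fin.insertNthEquiv, Equiv.coe_fn_mk,
      Fin.insertNth_last]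
    rfl
  · exact (hf.comp (MeasurableEquiv.measurable _)).aemeasurable

lemma lintegral_comp_smul_pi (n : ℕ) (f : (Fin n → ℝ) → ℝ≥0∞) {r : ℝ} (hr : 0 < r) :
    ∫⁻ l, f l = ENNReal.ofReal (r ^ n) * ∫⁻ l, f (r • l) := by
  have h := Measure.map_addHaar_smul (volume : Measure (Fin n → ℝ)) hr.ne'
  have h2 : ∫⁻ l, f (r • l) = ∫⁻ l, f l ∂(Measure.map (r • ·) volume) :=
    ((Homeomorph.smulOfNeZero r hr.ne').measurableEmbedding.lintegral_map f).symm
  rw [h2, h, lintegral_smul_measure, smul_eq_mul, ← mul_assoc, ← ENNReal.ofReal_mul (by positivity)]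
  simp [abs_of_pos hr, mul_inv_cancel₀ (pow_pos hr n).ne']

lemma lintegral_rpow_mul_exp_neg {s : ℝ} (hs : 0 < s) :
    ∫⁻ r in Ioi (0 : ℝ), ENNReal.ofReal (Real.exp (-r) * r ^ (s - 1))
      = ENNReal.ofReal (Real.Gamma s) := by
  rw [Real.Gamma_eq_integral hs, ofReal_integral_eq_lintegral_ofReal
    (Real.GammaIntegral_convergent hs)]
  filter_upwards [ae_restrict_mem measurableSet_Ioi] with r hr
  have : 0 < r := hr
  positivity

/-- Radial decomposition of the integral of a homogeneous function against `exp (-∑ xᵢ)`. -/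
lemma lintegral_orthant_homogeneous (n : ℕ) (g : (Fin (n + 1) → ℝ) → ℝ≥0∞) (hg : Measurable g)
    {δ : ℝ} (hδ : 0 < δ + n + 1)
    (hom : ∀ r : ℝ, 0 < r → ∀ x ∈ orthant (n + 1), g (r • x) = ENNReal.ofReal (r ^ δ) * g x) :
    ∫⁻ x in orthant (n + 1), g x * ENNReal.ofReal (Real.exp (-∑ i, x i))
      = ENNReal.ofReal (Real.Gamma (δ + n + 1))
        * ∫⁻ l : Fin n → ℝ in simplexDom (n + 1), g (simplexExt (n + 1) l) := by
  set f : (Fin (n + 1) → ℝ) → ℝ≥0∞ :=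
    (orthant (n + 1)).indicator fun x => g x * ENNReal.ofReal (Real.exp (-∑ i, x i)) with hf
  have hfm : Measurable f := Measurable.indicator (by fun_prop) (measurableSet_orthant _)
  have hsnoc : Measurable fun p : (Fin n → ℝ) × ℝ =>
      Fin.snoc (α := fun _ => ℝ) p.1 (p.2 - ∑ i, p.1 i) := by
    refine measurable_pi_lambda _ fun i => ?_
    refine Fin.lastCases ?_ (fun j => ?_) i
    · simp only [Fin.snoc_last]; fun_prop
    · simp only [Fin.snoc_castSucc]; fun_prop
  rw [← lintegral_indicator (measurableSet_orthant _), lintegral_fin_succ_snoc n _ hfm]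
  have h1 : ∀ l : Fin n → ℝ, ∫⁻ t : ℝ, f (Fin.snoc (α := fun _ => ℝ) l t)
      = ∫⁻ r : ℝ, f (Fin.snoc (α := fun _ => ℝ) l (r - ∑ i, l i)) := fun l =>
    (lintegral_sub_right_eq_self (fun t => f (Fin.snoc (α := fun _ => ℝ) l t)) _).symm
  simp_rw [h1]
  rw [lintegral_lintegral_swap
    (f := fun l r => f (Fin.snoc (α := fun _ => ℝ) l (r - ∑ i, l i)))
    (hfm.comp hsnoc).aemeasurable]
  have hneg : ∀ r : ℝ, r < 0 →
      ∫⁻ l : Fin n → ℝ, f (Fin.snoc (α := fun _ => ℝ) l (r - ∑ i, l i)) = 0 := by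
    intro r hr
    refine (lintegral_congr fun l => ?_).trans lintegral_zero
    refine Set.indicator_of_notMem (fun hmem => ?_) _
    simp only [orthant, Set.mem_ofPred_eq, Fin.forall_fin_succ', Fin.snoc_castSucc,
      Fin.snoc_last] at hmem
    have := Finset.sum_nonneg fun i (_ : i ∈ Finset.univ) => hmem.1 i
    linarith [hmem.2]
  have hpos : ∀ r : ℝ, 0 < r →
      ∫⁻ l : Fin n → ℝ, f (Fin.snoc (α := fun _ => ℝ) l (r - ∑ i, l i))
        = ENNReal.ofReal (Real.exp (-r) * r ^ (δ + n + 1 - 1))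
          * ∫⁻ l : Fin n → ℝ in simplexDom (n + 1), g (simplexExt (n + 1) l) := by
    intro r hr
    rw [lintegral_comp_smul_pi n _ hr]
    have h2 : ∀ l : Fin n → ℝ,
        f (Fin.snoc (α := fun _ => ℝ) (r • l) (r - ∑ i, (r • l) i))
          = ENNReal.ofReal (Real.exp (-r) * r ^ δ)
            * (simplexDom (n + 1)).indicator (fun l => g (simplexExt (n + 1) l)) l := by
      intro l
      have hs : Fin.snoc (α := fun _ => ℝ) (r • l) (r - ∑ i, (r • l) i)
          = r • simplexExt (n + 1) l := by
        rw [simplexExt_succ]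
        funext i
        refine Fin.lastCases ?_ (fun j => ?_) i
        · simp [mul_sub, Finset.mul_sum]
        · simp
      have hmem : r • simplexExt (n + 1) l ∈ orthant (n + 1) ↔ l ∈ simplexDom (n + 1) := by
        rw [← simplexExt_mem_orthant_iff]
        simp [orthant, hr]
      rw [hs, hf]
      by_cases hl : l ∈ simplexDom (n + 1)
      · rw [Set.indicator_of_mem (hmem.2 hl), Set.indicator_of_mem hl,
          hom r hr _ ((simplexExt_mem_orthant_iff n l).2 hl),
          ENNReal.ofReal_mul (by positivity)]
        have : ∑ i, (r • simplexExt (n + 1) l) i = r := by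
          rw [simplexExt_succ, Fin.sum_univ_castSucc]
          simp [← Finset.mul_sum, mul_sub]
        rw [this]
        ring
      · rw [Set.indicator_of_notMem (fun h => hl (hmem.1 h)), Set.indicator_of_notMem hl, mul_zero]
    simp_rw [h2]
    have hind : ∫⁻ l : Fin n → ℝ,
        (simplexDom (n + 1)).indicator (fun l => g (simplexExt (n + 1) l)) l
          = ∫⁻ l : Fin n → ℝ in simplexDom (n + 1), g (simplexExt (n + 1) l) :=
      lintegral_indicator (measurableSet_simplexDom (n + 1)) _
    rw [lintegral_const_mul' _ _ ENNReal.ofReal_ne_top, hind, ← mul_assoc,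
      ← ENNReal.ofReal_mul (by positivity)]
    congr 2
    rw [show δ + n + 1 - 1 = n + δ by ring, Real.rpow_add hr, Real.rpow_natCast]
    ring
  have hsplit : ∫⁻ r : ℝ, ∫⁻ l : Fin n → ℝ, f (Fin.snoc (α := fun _ => ℝ) l (r - ∑ i, l i))
      = ∫⁻ r in Ioi (0 : ℝ),
        ∫⁻ l : Fin n → ℝ, f (Fin.snoc (α := fun _ => ℝ) l (r - ∑ i, l i)) := by
    rw [← lintegral_add_compl _ (measurableSet_Ici (a := (0 : ℝ))),
      setLIntegral_congr Ioi_ae_eq_Ici.symm]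
    rw [Set.compl_Ici, setLIntegral_congr_fun (g := fun _ => 0) measurableSet_Iio
      (fun r hr => hneg r hr)]
    simp
  rw [hsplit, setLIntegral_congr_fun measurableSet_Ioi (fun r hr => hpos r hr),
    lintegral_mul_const _ (by fun_prop), lintegral_rpow_mul_exp_neg hδ]

lemma integral_orthant_homogeneous (n : ℕ) (g : (Fin (n + 1) → ℝ) → ℝ) (hg : Measurable g)
    (hg0 : ∀ x ∈ orthant (n + 1), 0 ≤ g x) {δ : ℝ} (hδ : 0 < δ + n + 1)
    (hom : ∀ r : ℝ, 0 < r → ∀ x ∈ orthant (n + 1), g (r • x) = r ^ δ * g x) :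
    ∫ x in orthant (n + 1), g x * Real.exp (-∑ i, x i)
      = Real.Gamma (δ + n + 1)
        * ∫ l : Fin n → ℝ in simplexDom (n + 1), g (simplexExt (n + 1) l) := by
  have h := lintegral_orthant_homogeneous n (fun x => ENNReal.ofReal (g x)) hg.ennreal_ofReal hδ
    (fun r hr x hx => by rw [hom r hr x hx, ENNReal.ofReal_mul (by positivity)])
  have hL : ∫ l : Fin n → ℝ in simplexDom (n + 1), g (simplexExt (n + 1) l)
      = (∫⁻ l : Fin n → ℝ in simplexDom (n + 1),
          ENNReal.ofReal (g (simplexExt (n + 1) l))).toReal := by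
    refine integral_eq_lintegral_of_nonneg_ae ?_ ?_
    · filter_upwards [ae_restrict_mem (measurableSet_simplexDom (n + 1))] with l hl
      exact hg0 _ ((simplexExt_mem_orthant_iff n l).2 hl)
    · exact (hg.comp (measurable_simplexExt_succ n)).aestronglyMeasurable
  have hR : ∫ x in orthant (n + 1), g x * Real.exp (-∑ i, x i)
      = (∫⁻ x in orthant (n + 1),
          ENNReal.ofReal (g x) * ENNReal.ofReal (Real.exp (-∑ i, x i))).toReal := by
    rw [integral_eq_lintegral_of_nonneg_ae]
    · congr 1
      exact setLIntegral_congr_fun (measurableSet_orthant _) fun x hx =>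
        ENNReal.ofReal_mul (hg0 x hx)
    · filter_upwards [ae_restrict_mem (measurableSet_orthant (n + 1))] with x hx
      exact mul_nonneg (hg0 x hx) (Real.exp_pos _).le
    · exact Measurable.aestronglyMeasurable (by fun_prop)
  rw [hR, hL, h, ENNReal.toReal_mul, ENNReal.toReal_ofReal (Real.Gamma_pos_of_pos hδ).le]

lemma measurable_gammaPDF (p : ℝ) : Measurable (ProbabilityTheory.gammaPDF p 1) :=
  (ProbabilityTheory.measurable_gammaPDFReal p 1).ennreal_ofReal

open ProbabilityTheory in
lemma gammaMeasure_ae_pos (p : ℝ) : ∀ᵐ x ∂gammaMeasure p 1, 0 < x := by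
  rw [gammaMeasure, ae_withDensity_iff (measurable_gammaPDF p)]
  have h0 : ∀ᵐ x : ℝ, x ≠ 0 := by simp [ae_iff]
  filter_upwards [h0] with x hx hne
  rcases lt_trichotomy x 0 with h | h | h
  · exact absurd (gammaPDF_of_neg h) hne
  · exact absurd h hx
  · exact h

lemma lintegral_fin_prod_eq_prod (m : ℕ) (f : Fin m → ℝ → ℝ≥0∞) (hf : ∀ i, Measurable (f i)) :
    ∫⁻ x : Fin m → ℝ, ∏ i, f i (x i) = ∏ i, ∫⁻ t, f i t := by
  induction m with
  | zero => simp [volume_pi]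
  | succ n ih =>
    have hm : Measurable fun x : Fin (n + 1) → ℝ => ∏ i, f i (x i) :=
      Finset.measurable_prod _ fun i _ => (hf i).comp (measurable_pi_apply i)
    have hm' : Measurable fun x : Fin n → ℝ => ∏ i : Fin n, f i.succ (x i) :=
      Finset.measurable_prod _ fun i _ => (hf i.succ).comp (measurable_pi_apply i)
    rw [← ((volume_preserving_piFinSuccAbove (fun _ : Fin (n + 1) => ℝ) 0).symm).lintegral_comp hm,
      Measure.volume_eq_prod, Fin.prod_univ_succ, ← ih (fun i => f i.succ) fun i => hf _,
      ← lintegral_prod_mul (hf 0).aemeasurable hm'.aemeasurable]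
    refine lintegral_congr fun x => ?_
    simp only [MeasurableEquiv.piFinSuccAbove_symm_apply, Fin.insertNthEquiv, Equiv.coe_fn_mk,
      Fin.prod_univ_succ, Fin.insertNth_zero, Fin.cons_zero, Fin.cons_succ]
    rfl

/-- The law of independent `Gamma(P i, 1)` variables. -/
def gammaPi {m : ℕ} (P : Fin m → ℝ) : Measure (Fin m → ℝ) :=
  Measure.pi fun i => ProbabilityTheory.gammaMeasure (P i) 1

section GammaPi

open ProbabilityTheory

variable {m : ℕ} {P : Fin m → ℝ}

lemma isProbabilityMeasure_gammaPi (hP : ∀ i, 0 < P i) : IsProbabilityMeasure (gammaPi P) := by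
  have := fun i => isProbabilityMeasure_gammaMeasure (hP i) one_pos
  unfold gammaPi
  infer_instance

lemma gammaPi_ae_pos (hP : ∀ i, 0 < P i) : ∀ᵐ x ∂gammaPi P, ∀ i, 0 < x i := by
  have := fun i => isProbabilityMeasure_gammaMeasure (hP i) one_pos
  rw [ae_all_iff]
  exact fun i => (Measure.quasiMeasurePreserving_eval
    (μ := fun i => gammaMeasure (P i) 1) i).ae (gammaMeasure_ae_pos (P i))

lemma gammaPi_eq_withDensity (hP : ∀ i, 0 < P i) :
    gammaPi P = (volume : Measure (Fin m → ℝ)).withDensity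
      (fun x => ∏ i, gammaPDF (P i) 1 (x i)) := by
  have := fun i => isProbabilityMeasure_gammaMeasure (hP i) one_pos
  refine Measure.pi_eq fun s hs => ?_
  rw [withDensity_apply _ (MeasurableSet.univ_pi hs),
    ← lintegral_indicator (MeasurableSet.univ_pi hs)]
  have h1 : ∀ x : Fin m → ℝ,
      (Set.univ.pi s).indicator (fun x => ∏ i, gammaPDF (P i) 1 (x i)) x
        = ∏ i, (s i).indicator (gammaPDF (P i) 1) (x i) := by
    intro x
    by_cases hx : x ∈ Set.univ.pi s
    · rw [Set.indicator_of_mem hx]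
      exact Finset.prod_congr rfl fun i _ => (Set.indicator_of_mem (hx i trivial) _).symm
    · rw [Set.indicator_of_notMem hx]
      simp only [Set.mem_pi, Set.mem_univ, true_imp_iff, not_forall] at hx
      obtain ⟨i, hi⟩ := hx
      exact (Finset.prod_eq_zero (Finset.mem_univ i) (Set.indicator_of_notMem hi _)).symm
  simp_rw [h1]
  rw [lintegral_fin_prod_eq_prod m _ fun i => (measurable_gammaPDF (P i)).indicator (hs i)]
  refine Finset.prod_congr rfl fun i _ => ?_
  rw [lintegral_indicator (hs i), gammaMeasure, withDensity_apply _ (hs i)]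

lemma integral_orthant_eq_gammaPi (hP : ∀ i, 0 < P i) (F : (Fin m → ℝ) → ℝ) :
    ∫ x in orthant m, F x * ∏ i, (x i ^ (P i - 1) * Real.exp (-x i))
      = (∏ i, Real.Gamma (P i)) * ∫ x, F x ∂gammaPi P := by
  have hmeas : Measurable fun x : Fin m → ℝ => ∏ i, gammaPDF (P i) 1 (x i) :=
    Finset.measurable_prod _ fun i _ =>
      (measurable_gammaPDF (P i)).comp (measurable_pi_apply i)
  rw [gammaPi_eq_withDensity hP, integral_withDensity_eq_integral_toReal_smul hmeas
    (Filter.Eventually.of_forall fun x => ENNReal.prod_lt_top fun i _ => ENNReal.ofReal_lt_top),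
    ← integral_const_mul, ← integral_indicator (measurableSet_orthant m)]
  refine integral_congr_ae (Filter.Eventually.of_forall fun x => ?_)
  simp only [smul_eq_mul, ENNReal.toReal_prod, gammaPDF]
  by_cases hx : x ∈ orthant m
  · rw [Set.indicator_of_mem hx]
    have h1 : ∀ i, x i ^ (P i - 1) * Real.exp (-x i)
        = Real.Gamma (P i) * (ENNReal.ofReal (gammaPDFReal (P i) 1 (x i))).toReal := by
      intro i
      have := (Real.Gamma_pos_of_pos (hP i)).ne'
      rw [ENNReal.toReal_ofReal (gammaPDFReal_nonneg (hP i) one_pos _), gammaPDFReal, if_pos (hx i)]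
      simp only [Real.one_rpow, one_mul]
      field_simp
    simp_rw [h1]
    rw [Finset.prod_mul_distrib]
    ring
  · rw [Set.indicator_of_notMem hx]
    simp only [orthant, Set.mem_ofPred_eq, not_forall, not_le] at hx
    obtain ⟨i, hi⟩ := hx
    have hz : gammaPDFReal (P i) 1 (x i) = 0 := if_neg (not_le.2 hi)
    rw [Finset.prod_eq_zero (f := fun i => (ENNReal.ofReal (gammaPDFReal (P i) 1 (x i))).toReal)
      (Finset.mem_univ i) (by simp [hz])]
    simp

lemma iIndepFun_gammaPi (hP : ∀ i, 0 < P i) :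
    iIndepFun (fun i (x : Fin m → ℝ) => x i) (gammaPi P) := by
  have := fun i => isProbabilityMeasure_gammaMeasure (hP i) one_pos
  exact iIndepFun_pi (μ := fun i => gammaMeasure (P i) 1) (X := fun _ x => x)
    fun i => aemeasurable_id

lemma map_gammaPi_comp (hP : ∀ i, 0 < P i) {k : ℕ} {e : Fin k → Fin m}
    (he : Function.Injective e) :
    (gammaPi P).map (fun x i => x (e i)) = gammaPi (P ∘ e) := by
  have := fun i => isProbabilityMeasure_gammaMeasure (hP i) one_pos
  have := isProbabilityMeasure_gammaPi hP
  have h := (iIndepFun_iff_map_fun_eq_pi_map fun i => (measurable_pi_apply (e i)).aemeasurable).1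
    ((iIndepFun_gammaPi hP).precomp he)
  rw [h]
  unfold gammaPi
  congr 1
  funext i
  exact (measurePreserving_eval (fun i => gammaMeasure (P i) 1) (e i)).map_eq

lemma integral_gammaPi_fst_div_add {P : Fin 2 → ℝ} (hP : ∀ i, 0 < P i) :
    ∫ x, x 0 / (x 0 + x 1) ∂gammaPi P = P 0 / (P 0 + P 1) := by
  have h0 := hP 0
  have h1 := hP 1
  have hG0 := Real.Gamma_pos_of_pos h0
  have hG1 := Real.Gamma_pos_of_pos h1
  have hG := Real.Gamma_pos_of_pos (add_pos h0 h1)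
  have hsum : ∀ l : Fin 1 → ℝ, simplexExt 2 l 0 + simplexExt 2 l 1 = 1 := by
    intro l
    simp [simplexExt]
  have hA := integral_orthant_homogeneous 1
    (fun x => x 0 ^ (P 0 - 1) * x 1 ^ (P 1 - 1) * (x 0 / (x 0 + x 1))) (by fun_prop)
    (fun x hx => by
      have := hx 0
      have := hx 1
      positivity) (δ := P 0 + P 1 - 2) (by push_cast; linarith)
    (fun r hr x hx => by
      simp only [Pi.smul_apply, smul_eq_mul]
      rw [Real.mul_rpow hr.le (hx 0), Real.mul_rpow hr.le (hx 1), ← mul_add,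
        mul_div_mul_left _ _ hr.ne',
        show P 0 + P 1 - 2 = (P 0 - 1) + (P 1 - 1) by ring, Real.rpow_add hr]
      ring)
  have hB := integral_orthant_homogeneous 1
    (fun x => x 0 ^ (P 0 - 1) * x 1 ^ (P 1 - 1) * x 0) (by fun_prop)
    (fun x hx => by
      have := hx 0
      have := hx 1
      positivity) (δ := P 0 + P 1 - 1) (by push_cast; linarith)
    (fun r hr x hx => by
      simp only [Pi.smul_apply, smul_eq_mul]
      rw [Real.mul_rpow hr.le (hx 0), Real.mul_rpow hr.le (hx 1),
        show P 0 + P 1 - 1 = (P 0 - 1) + (P 1 - 1) + 1 by ring, Real.rpow_add hr,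
        Real.rpow_add hr, Real.rpow_one]
      ring)
  simp only [hsum, div_one] at hA
  set K := ∫ l : Fin 1 → ℝ in simplexDom (1 + 1),
    simplexExt (1 + 1) l 0 ^ (P 0 - 1) * simplexExt (1 + 1) l 1 ^ (P 1 - 1)
      * simplexExt (1 + 1) l 0 with hK
  have hA' := integral_orthant_eq_gammaPi hP (fun x => x 0 / (x 0 + x 1))
  have hP' : ∀ i, 0 < (![P 0 + 1, P 1] : Fin 2 → ℝ) i := by
    intro i
    fin_cases i
    · simpa using by linarith
    · simpa using h1
  have hB' := integral_orthant_eq_gammaPi hP' (fun _ => 1)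
  have := isProbabilityMeasure_gammaPi hP'
  have hexp : ∀ x : Fin 2 → ℝ,
      Real.exp (-∑ i : Fin (1 + 1), x i) = Real.exp (-x 0) * Real.exp (-x 1) := fun x => by
    rw [show ∑ i : Fin (1 + 1), x i = x 0 + x 1 from Fin.sum_univ_two x, neg_add, Real.exp_add]
  have hA2 : ∫ x in orthant 2, x 0 / (x 0 + x 1) * ∏ i, (x i ^ (P i - 1) * Real.exp (-x i))
      = Real.Gamma (P 0 + P 1) * K := by
    rw [show P 0 + P 1 = P 0 + P 1 - 2 + (1 : ℕ) + 1 by push_cast; ring, ← hA]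
    refine integral_congr_ae (Filter.Eventually.of_forall fun x => ?_)
    simp only [Fin.prod_univ_two, hexp]
    ring
  have hB2 : ∫ x in orthant 2, (1 : ℝ) * ∏ i, (x i ^ ((![P 0 + 1, P 1] : Fin 2 → ℝ) i - 1)
      * Real.exp (-x i)) = Real.Gamma (P 0 + P 1 + 1) * K := by
    rw [show P 0 + P 1 + 1 = P 0 + P 1 - 1 + (1 : ℕ) + 1 by push_cast; ring, ← hB]
    refine setIntegral_congr_fun (measurableSet_orthant 2) fun x hx => ?_
    have : x 0 ^ (P 0 - 1) * x 0 = x 0 ^ P 0 := by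
      rw [← Real.rpow_add_one' (hx 0) (by linarith)]
      ring_nf
    simp only [Fin.prod_univ_two, hexp]
    simp only [Matrix.cons_val_zero, Matrix.cons_val_one, add_sub_cancel_right, ← this]
    ring
  rw [hA2] at hA'
  rw [hB2] at hB'
  simp only [Fin.prod_univ_two, Matrix.cons_val_zero, Matrix.cons_val_one, integral_const,
    probReal_univ, smul_eq_mul, mul_one] at hA' hB'
  rw [Real.Gamma_add_one h0.ne', Real.Gamma_add_one (by linarith)] at hB'
  have h2 : P 0 + P 1 ≠ 0 := by linarith
  rw [eq_div_iff h2]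
  have h3 : Real.Gamma (P 0) * Real.Gamma (P 1) ≠ 0 := by positivity
  apply mul_left_cancel₀ h3
  linear_combination (-(P 0 + P 1)) * hA' + hB'

end GammaPi

section SchurPfaffian

variable {m : ℕ}

/-- The Schur kernel `(u - v) / (u + v)`. -/
def schurKer (u v : ℝ) : ℝ := (u - v) / (u + v)

lemma schurKer_antisymm (u v : ℝ) : schurKer u v = -schurKer v u := by
  unfold schurKer
  rw [← neg_div, neg_sub, add_comm]

/-- The product of `f i j` over pairs `i < j` in `s`. -/
def pairProd (s : Finset (Fin m)) (f : Fin m → Fin m → ℝ) : ℝ :=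
  ∏ i ∈ s, ∏ j ∈ s with i < j, f i j

lemma pairProd_insert {s : Finset (Fin m)} {a : Fin m} (ha : a ∉ s) (f : Fin m → Fin m → ℝ) :
    pairProd (insert a s) f = (∏ k ∈ s, if a < k then f a k else f k a) * pairProd s f := by
  unfold pairProd
  simp only [Finset.prod_filter]
  rw [Finset.prod_insert ha, Finset.prod_insert ha, if_neg (lt_irrefl a), one_mul]
  have h1 : ∏ i ∈ s, ∏ j ∈ insert a s, (if i < j then f i j else 1)
      = (∏ i ∈ s, if i < a then f i a else 1)
        * ∏ i ∈ s, ∏ j ∈ s, if i < j then f i j else 1 := by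
    rw [← Finset.prod_mul_distrib]
    exact Finset.prod_congr rfl fun i _ => Finset.prod_insert ha
  rw [h1, ← mul_assoc, ← Finset.prod_mul_distrib]
  congr 1
  refine Finset.prod_congr rfl fun k hk => ?_
  rcases lt_trichotomy a k with h | h | h
  · simp [h, h.not_gt]
  · exact absurd (h ▸ hk) ha
  · simp [h, h.not_gt]

lemma pairProd_eq_erase {s : Finset (Fin m)} {a : Fin m} (ha : a ∈ s) (f : Fin m → Fin m → ℝ) :
    pairProd s f
      = (∏ k ∈ s.erase a, if a < k then f a k else f k a) * pairProd (s.erase a) f := by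
  rw [← pairProd_insert (Finset.notMem_erase a s), Finset.insert_erase ha]

/-- The partial fraction coefficients of `∏ j ∈ s, (t - x j) / (t + x j)`. -/
def pfCoeff (s : Finset (Fin m)) (x : Fin m → ℝ) (j : Fin m) : ℝ :=
  ∏ k ∈ s.erase j, (x j + x k) / (x j - x k)

/-- The indicator of even natural numbers. -/
def evenInd (n : ℕ) : ℝ := (1 + (-1) ^ n) / 2

lemma prod_schurKer_eq (s : Finset (Fin m)) (x : Fin m → ℝ) (hx : ∀ j ∈ s, 0 < x j)
    (hinj : Set.InjOn x s) (t : ℝ) (ht : ∀ j ∈ s, t + x j ≠ 0) :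
    ∏ j ∈ s, schurKer t (x j) = evenInd #s + ∑ j ∈ s, pfCoeff s x j * schurKer t (x j) := by
  induction s using Finset.induction_on generalizing t with
  | empty => simp [evenInd]
  | insert b s hb ih =>
    have hxs : ∀ j ∈ s, 0 < x j := fun j hj => hx j (Finset.mem_insert_of_mem hj)
    have hxb : 0 < x b := hx b (Finset.mem_insert_self b s)
    have hinjs : Set.InjOn x s := hinj.mono (by simp)
    have hne : ∀ j ∈ s, x j - x b ≠ 0 := by
      intro j hj h
      have := hinj (Finset.mem_coe.2 (Finset.mem_insert_of_mem hj))
        (Finset.mem_coe.2 (Finset.mem_insert_self b s)) (sub_eq_zero.1 h)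
      exact hb (this ▸ hj)
    have ih' := ih hxs hinjs
    have hzero : (-1 : ℝ) ^ #s = evenInd #s - ∑ j ∈ s, pfCoeff s x j := by
      have h := ih' 0 fun j hj => by simpa using (hxs j hj).ne'
      have h0 : ∀ j ∈ s, schurKer 0 (x j) = -1 := by
        intro j hj
        have := (hxs j hj).ne'
        simp [schurKer, this]
      rw [Finset.prod_congr rfl h0, Finset.prod_const,
        Finset.sum_congr rfl fun j hj => by rw [h0 j hj, mul_neg_one]] at h
      rw [h, Finset.sum_neg_distrib, sub_eq_add_neg]
    have hcb : pfCoeff (insert b s) x b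
        = evenInd #s - ∑ j ∈ s, pfCoeff s x j * ((x j + x b) / (x j - x b)) := by
      have h := ih' (-x b) fun j hj => by
        rw [neg_add_eq_sub]
        exact hne j hj
      have hk : ∀ j ∈ s, schurKer (-x b) (x j) = -((x j + x b) / (x j - x b)) := by
        intro j hj
        rw [schurKer, ← neg_div]
        congr 1 <;> ring
      rw [pfCoeff, Finset.erase_insert hb]
      have hk' : ∀ j ∈ s, (x b + x j) / (x b - x j) = schurKer (-x b) (x j) := by
        intro j hj
        rw [schurKer, ← neg_div_neg_eq]
        congr 1 <;> ring
      rw [Finset.prod_congr rfl hk', h, sub_eq_add_neg, ← Finset.sum_neg_distrib]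
      congr 1
      exact Finset.sum_congr rfl fun j hj => by rw [hk j hj, mul_neg]
    have hcj : ∀ j ∈ s, pfCoeff (insert b s) x j
        = pfCoeff s x j * ((x j + x b) / (x j - x b)) := by
      intro j hj
      have hjb : b ≠ j := fun h => hb (h ▸ hj)
      rw [pfCoeff, Finset.erase_insert_of_ne hjb, Finset.prod_insert (by simp [hb]), mul_comm]
      rfl
    have hprod : ∀ j ∈ s, schurKer t (x j) * schurKer t (x b)
        = 1 + (x j + x b) / (x j - x b) * (schurKer t (x j) - schurKer t (x b)) := by
      intro j hj
      have h1 := ht j (Finset.mem_insert_of_mem hj)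
      have h2 := ht b (Finset.mem_insert_self b s)
      have h3 := hne j hj
      unfold schurKer
      field_simp
      ring
    rw [Finset.prod_insert hb, ih' t fun j hj => ht j (Finset.mem_insert_of_mem hj),
      Finset.sum_insert hb, Finset.card_insert_of_notMem hb, hcb]
    have hsum : ∑ j ∈ s, pfCoeff (insert b s) x j * schurKer t (x j)
        = ∑ j ∈ s, pfCoeff s x j * ((x j + x b) / (x j - x b)) * schurKer t (x j) :=
      Finset.sum_congr rfl fun j hj => by rw [hcj j hj]
    rw [hsum]
    have h4 : schurKer t (x b) * ∑ j ∈ s, pfCoeff s x j * schurKer t (x j)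
        = ∑ j ∈ s, pfCoeff s x j
          + ∑ j ∈ s, pfCoeff s x j * ((x j + x b) / (x j - x b)) * schurKer t (x j)
          - (∑ j ∈ s, pfCoeff s x j * ((x j + x b) / (x j - x b))) * schurKer t (x b) := by
      rw [Finset.mul_sum, Finset.sum_mul, ← Finset.sum_add_distrib, ← Finset.sum_sub_distrib]
      refine Finset.sum_congr rfl fun j hj => ?_
      linear_combination pfCoeff s x j * hprod j hj
    rw [mul_add, h4]
    unfold evenInd at *
    rw [pow_succ]
    linear_combination hzero

/-- The sign incurred by moving `j` to the front of `s`. -/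
def moveSign (s : Finset (Fin m)) (j : Fin m) : ℝ :=
  ∏ k ∈ s.erase j, if j < k then 1 else -1

lemma pfCoeff_mul_pairProd {s : Finset (Fin m)} {x : Fin m → ℝ} (hx : ∀ j ∈ s, 0 < x j)
    (hinj : Set.InjOn x s) {j : Fin m} (hj : j ∈ s) :
    pfCoeff s x j * pairProd s (fun i k => schurKer (x i) (x k))
      = moveSign s j * pairProd (s.erase j) (fun i k => schurKer (x i) (x k)) := by
  rw [pairProd_eq_erase hj, ← mul_assoc, pfCoeff, moveSign, ← Finset.prod_mul_distrib]
  congr 1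
  refine Finset.prod_congr rfl fun k hk => ?_
  have hks := Finset.mem_of_mem_erase hk
  have h1 : x j - x k ≠ 0 := fun h =>
    Finset.ne_of_mem_erase hk (hinj hks hj (sub_eq_zero.1 h).symm)
  have h2 : x j + x k ≠ 0 := (add_pos (hx j hj) (hx k hks)).ne'
  split_ifs
  · unfold schurKer
    field_simp
  · rw [schurKer_antisymm]
    unfold schurKer
    field_simp

lemma pairProd_schurKer_insert_of_injOn {s : Finset (Fin m)} {a : Fin m} (ha : ∀ k ∈ s, a < k)
    {x : Fin m → ℝ} (hx : ∀ j, 0 < x j) (hinj : Set.InjOn x s) :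
    pairProd (insert a s) (fun i k => schurKer (x i) (x k))
      = evenInd #s * pairProd s (fun i k => schurKer (x i) (x k))
        + ∑ j ∈ s, moveSign s j
          * (schurKer (x a) (x j) * pairProd (s.erase j) (fun i k => schurKer (x i) (x k))) := by
  rw [pairProd_insert fun h => lt_irrefl a (ha a h),
    Finset.prod_congr rfl fun k hk => if_pos (ha k hk),
    prod_schurKer_eq s x (fun j _ => hx j) hinj (x a) fun j _ => (add_pos (hx a) (hx j)).ne',
    add_mul, Finset.sum_mul]
  congr 1
  refine Finset.sum_congr rfl fun j hj => ?_
  linear_combination schurKer (x a) (x j) * pfCoeff_mul_pairProd (fun j _ => hx j) hinj hj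

/-- Expansion of the Schur Pfaffian along its smallest index. -/
lemma pairProd_schurKer_insert {s : Finset (Fin m)} {a : Fin m} (ha : ∀ k ∈ s, a < k)
    {x : Fin m → ℝ} (hx : ∀ j, 0 < x j) :
    pairProd (insert a s) (fun i k => schurKer (x i) (x k))
      = evenInd #s * pairProd s (fun i k => schurKer (x i) (x k))
        + ∑ j ∈ s, moveSign s j
          * (schurKer (x a) (x j) * pairProd (s.erase j) (fun i k => schurKer (x i) (x k))) := by
  set y : ℝ → Fin m → ℝ := fun t i => x i + t * (i : ℕ) with hy
  have hker : ∀ i k, Filter.Tendsto (fun t => schurKer (y t i) (y t k)) (nhdsWithin 0 (Ioi 0))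
      (nhds (schurKer (x i) (x k))) := by
    intro i k
    have hc : ContinuousAt (fun t => schurKer (y t i) (y t k)) 0 := by
      unfold schurKer
      refine ContinuousAt.div (by fun_prop) (by fun_prop) ?_
      simpa [hy] using (add_pos (hx i) (hx k)).ne'
    have h := hc.tendsto.mono_left (nhdsWithin_le_nhds (s := Ioi 0))
    simpa [hy] using h
  have hpair : ∀ s : Finset (Fin m),
      Filter.Tendsto (fun t => pairProd s (fun i k => schurKer (y t i) (y t k)))
        (nhdsWithin 0 (Ioi 0)) (nhds (pairProd s (fun i k => schurKer (x i) (x k)))) := fun s =>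
    tendsto_finsetProd _ fun i _ => tendsto_finsetProd _ fun k _ => hker i k
  have hR := ((hpair s).const_mul (evenInd #s)).add
    (tendsto_finsetSum s fun j _ =>
      (((hker a j).mul (hpair (s.erase j))).const_mul (moveSign s j)))
  refine tendsto_nhds_unique (hpair (insert a s)) (hR.congr' ?_)
  have hne : ∀ i k : Fin m, ∀ᶠ t in nhdsWithin (0 : ℝ) (Ioi 0), y t i = y t k → i = k := by
    intro i k
    by_cases hik : i = k
    · exact Filter.Eventually.of_forall fun t _ => hik
    have hik' : ((k : ℕ) : ℝ) - (i : ℕ) ≠ 0 := by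
      rw [sub_ne_zero]
      exact fun h => hik (Fin.ext (by exact_mod_cast h.symm))
    have hkey : ∀ t, y t i = y t k → t = (x i - x k) / ((k : ℕ) - (i : ℕ)) := by
      intro t h
      rw [eq_div_iff hik']
      simp only [hy] at h
      linear_combination -h
    by_cases hxx : x i - x k = 0
    · filter_upwards [self_mem_nhdsWithin] with t ht h
      have := hkey t h
      rw [hxx, zero_div] at this
      exact absurd this (ne_of_gt ht)
    · have h0 : (0 : ℝ) ≠ (x i - x k) / ((k : ℕ) - (i : ℕ)) := (div_ne_zero hxx hik').symm
      filter_upwards [nhdsWithin_le_nhds (eventually_ne_nhds h0)] with t ht h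
      exact absurd (hkey t h) ht
  have hall : ∀ᶠ t in nhdsWithin (0 : ℝ) (Ioi 0), ∀ i k : Fin m, y t i = y t k → i = k := by
    simp only [Filter.eventually_all]
    exact hne
  filter_upwards [hall, self_mem_nhdsWithin] with t hinj ht
  have hpos : ∀ j, 0 < y t j := fun j =>
    add_pos_of_pos_of_nonneg (hx j) (mul_nonneg (le_of_lt ht) (Nat.cast_nonneg _))
  exact (pairProd_schurKer_insert_of_injOn ha hpos fun i _ k _ h => hinj i k h).symm

end SchurPfaffian

section SchurExpectation

open ProbabilityTheory

variable {m : ℕ} {P : Fin m → ℝ}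

lemma schurKer_eq_two_mul_div_sub_one {u v : ℝ} (h : u + v ≠ 0) :
    schurKer u v = 2 * (u / (u + v)) - 1 := by
  unfold schurKer
  field_simp
  ring

lemma abs_schurKer_le_one {u v : ℝ} (hu : 0 < u) (hv : 0 < v) : |schurKer u v| ≤ 1 := by
  unfold schurKer
  rw [abs_div, abs_of_pos (add_pos hu hv), div_le_one (add_pos hu hv), abs_le]
  constructor <;> linarith

lemma abs_pairProd_schurKer_le_one (s : Finset (Fin m)) {x : Fin m → ℝ} (hx : ∀ i, 0 < x i) :
    |pairProd s fun i k => schurKer (x i) (x k)| ≤ 1 := by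
  unfold pairProd
  rw [Finset.abs_prod]
  refine Finset.prod_le_one (fun _ _ => abs_nonneg _) fun i _ => ?_
  rw [Finset.abs_prod]
  exact Finset.prod_le_one (fun _ _ => abs_nonneg _) fun k _ => abs_schurKer_le_one (hx i) (hx k)

lemma measurable_schurKer {α : Type*} [MeasurableSpace α] {f g : α → ℝ} (hf : Measurable f)
    (hg : Measurable g) : Measurable fun x => schurKer (f x) (g x) := by
  unfold schurKer
  fun_prop

lemma measurable_pairProd_schurKer (s : Finset (Fin m)) :
    Measurable fun x : Fin m → ℝ => pairProd s fun i k => schurKer (x i) (x k) :=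
  Finset.measurable_fun_prod _ fun i _ => Finset.measurable_fun_prod _ fun k _ =>
    measurable_schurKer (measurable_pi_apply i) (measurable_pi_apply k)

lemma integrable_pairProd_schurKer (hP : ∀ i, 0 < P i) (s : Finset (Fin m)) :
    Integrable (fun x => pairProd s fun i k => schurKer (x i) (x k)) (gammaPi P) := by
  have := isProbabilityMeasure_gammaPi hP
  refine Integrable.of_bound (measurable_pairProd_schurKer s).aestronglyMeasurable 1 ?_
  filter_upwards [gammaPi_ae_pos hP] with x hx
  exact abs_pairProd_schurKer_le_one s hx

lemma integrable_schurKer_mul_pairProd (hP : ∀ i, 0 < P i) (a j : Fin m) (s : Finset (Fin m)) :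
    Integrable (fun x => schurKer (x a) (x j) * pairProd s fun i k => schurKer (x i) (x k))
      (gammaPi P) := by
  have := isProbabilityMeasure_gammaPi hP
  refine Integrable.of_bound ((measurable_schurKer (measurable_pi_apply a)
    (measurable_pi_apply j)).mul (measurable_pairProd_schurKer s)).aestronglyMeasurable 1 ?_
  filter_upwards [gammaPi_ae_pos hP] with x hx
  rw [Real.norm_eq_abs, abs_mul]
  exact mul_le_one₀ (abs_schurKer_le_one (hx a) (hx j)) (abs_nonneg _)
    (abs_pairProd_schurKer_le_one s hx)

lemma integral_schurKer_gammaPi (hP : ∀ i, 0 < P i) {i j : Fin m} (hij : i ≠ j) :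
    ∫ x, schurKer (x i) (x j) ∂gammaPi P = schurKer (P i) (P j) := by
  have he : Function.Injective ![i, j] := by
    intro u v h
    fin_cases u <;> fin_cases v <;> simp_all
  have hP2 : ∀ u, 0 < (P ∘ ![i, j]) u := fun u => hP _
  have := isProbabilityMeasure_gammaPi hP2
  have hmap := map_gammaPi_comp hP he
  have h1 : ∫ x, schurKer (x i) (x j) ∂gammaPi P
      = ∫ y, schurKer (y 0) (y 1) ∂gammaPi (P ∘ ![i, j]) := by
    rw [← hmap, integral_map
      (measurable_pi_lambda _ fun u => measurable_pi_apply _).aemeasurable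
      (measurable_schurKer (measurable_pi_apply 0) (measurable_pi_apply 1)).aestronglyMeasurable]
    simp
  have hae : ∀ᵐ y ∂gammaPi (P ∘ ![i, j]), schurKer (y 0) (y 1) = 2 * (y 0 / (y 0 + y 1)) - 1 := by
    filter_upwards [gammaPi_ae_pos hP2] with y hy
    exact schurKer_eq_two_mul_div_sub_one (add_pos (hy 0) (hy 1)).ne'
  have hint : Integrable (fun y : Fin 2 → ℝ => y 0 / (y 0 + y 1)) (gammaPi (P ∘ ![i, j])) := by
    refine Integrable.of_bound (Measurable.aestronglyMeasurable (by fun_prop)) 1 ?_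
    filter_upwards [gammaPi_ae_pos hP2] with y hy
    have h0 := hy 0
    have h1 := hy 1
    rw [Real.norm_eq_abs, abs_of_nonneg (by positivity), div_le_one (by positivity)]
    linarith
  rw [h1, integral_congr_ae hae, integral_sub (hint.const_mul 2) (integrable_const 1),
    integral_const_mul, integral_gammaPi_fst_div_add hP2,
    schurKer_eq_two_mul_div_sub_one (add_pos (hP i) (hP j)).ne']
  simp

lemma integral_schurKer_mul_pairProd (hP : ∀ i, 0 < P i) {s : Finset (Fin m)} {a j : Fin m}
    (haj : a ≠ j) (ha : a ∉ s) (hj : j ∉ s) :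
    ∫ x, schurKer (x a) (x j) * pairProd s (fun i k => schurKer (x i) (x k)) ∂gammaPi P
      = schurKer (P a) (P j)
        * ∫ x, pairProd s (fun i k => schurKer (x i) (x k)) ∂gammaPi P := by
  have hdisj : Disjoint ({a, j} : Finset (Fin m)) s := by simp [ha, hj]
  have hind := (iIndepFun_gammaPi hP).indepFun_finset {a, j} s hdisj
    fun i => (measurable_pi_apply i)
  let F : (({a, j} : Finset (Fin m)) → ℝ) → ℝ := fun y =>
    schurKer (y ⟨a, by simp⟩) (y ⟨j, by simp⟩)
  let G : (s → ℝ) → ℝ := fun y =>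
    ∏ i : s, ∏ k : s with i < k, schurKer (y i) (y k)
  have hF : Measurable F := measurable_schurKer (measurable_pi_apply _) (measurable_pi_apply _)
  have hG : Measurable G := Finset.measurable_fun_prod _ fun i _ =>
    Finset.measurable_fun_prod _ fun k _ =>
      measurable_schurKer (measurable_pi_apply i) (measurable_pi_apply k)
  have hGeq : ∀ x : Fin m → ℝ, G (fun i => x i) = pairProd s fun i k => schurKer (x i) (x k) := by
    intro x
    simp only [G, pairProd, Finset.prod_filter]
    rw [← Finset.prod_coe_sort s]
    refine Finset.prod_congr rfl fun i _ => ?_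
    rw [← Finset.prod_coe_sort s]
    rfl
  have h := (hind.comp hF hG).integral_fun_mul_eq_mul_integral
    (hF.comp (measurable_pi_lambda _ fun i => measurable_pi_apply _)).aestronglyMeasurable
    (hG.comp (measurable_pi_lambda _ fun i => measurable_pi_apply _)).aestronglyMeasurable
  simp only [Function.comp_apply, hGeq] at h
  rw [h]
  congr 1
  exact integral_schurKer_gammaPi hP haj

/-- The Schur product of independent Gamma variables has the Schur product of the shape
parameters as its mean. -/
theorem integral_pairProd_schurKer_gammaPi (hP : ∀ i, 0 < P i) (s : Finset (Fin m)) :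
    ∫ x, pairProd s (fun i k => schurKer (x i) (x k)) ∂gammaPi P
      = pairProd s fun i k => schurKer (P i) (P k) := by
  have := isProbabilityMeasure_gammaPi hP
  induction s using Finset.strongInduction with
  | H s ih =>
    rcases s.eq_empty_or_nonempty with rfl | hs
    · simp [pairProd]
    obtain ⟨a, t, hat, rfl⟩ : ∃ a t, (∀ k ∈ t, a < k) ∧ insert a t = s := by
      refine ⟨s.min' hs, s.erase (s.min' hs), fun k hk => s.min'_lt_of_mem_erase_min' hs hk,
        Finset.insert_erase (s.min'_mem hs)⟩
    have hnot : a ∉ t := fun h => lt_irrefl a (hat a h)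
    rw [integral_congr_ae ((gammaPi_ae_pos hP).mono fun x hx => pairProd_schurKer_insert hat hx),
      pairProd_schurKer_insert hat hP, integral_add
      ((integrable_pairProd_schurKer hP t).const_mul _)
      (integrable_finsetSum _ fun j _ =>
        (integrable_schurKer_mul_pairProd hP a j (t.erase j)).const_mul _),
      integral_const_mul, ih t (Finset.ssubset_insert hnot),
      integral_finsetSum _ fun j _ =>
        (integrable_schurKer_mul_pairProd hP a j (t.erase j)).const_mul _]
    congr 1
    refine Finset.sum_congr rfl fun j hj => ?_
    rw [integral_const_mul, integral_schurKer_mul_pairProd hP (hat j hj).ne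
      (fun h => hnot (Finset.mem_of_mem_erase h)) (Finset.notMem_erase j t),
      ih (t.erase j) ((Finset.erase_subset j t).trans_ssubset (Finset.ssubset_insert hnot))]

/-- The integral of the Schur product against monomials and the exponential weight. -/
theorem integral_orthant_pairProd_schurKer (hP : ∀ i, 0 < P i) :
    ∫ x in orthant m, pairProd Finset.univ (fun i k => schurKer (x i) (x k))
        * ∏ i, (x i ^ (P i - 1) * Real.exp (-x i))
      = (∏ i, Real.Gamma (P i)) * pairProd Finset.univ fun i k => schurKer (P i) (P k) := by
  rw [integral_orthant_eq_gammaPi hP, integral_pairProd_schurKer_gammaPi hP]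

end SchurExpectation

section Antisymmetrization

variable {m : ℕ}

/-- The value of the Schur product integral with shape parameters `Q`. -/
def gammaSchur (Q : Fin m → ℝ) : ℝ :=
  (∏ i, Real.Gamma (Q i)) * pairProd Finset.univ fun i k => schurKer (Q i) (Q k)

lemma pairProd_univ (f : Fin m → Fin m → ℝ) :
    pairProd Finset.univ f = ∏ i, ∏ j ∈ Finset.Ioi i, f i j := by
  unfold pairProd
  refine Finset.prod_congr rfl fun i _ => Finset.prod_congr ?_ fun _ _ => rfl
  ext j
  simp

lemma prod_lt_pairs_eq_pairProd (f : Fin m → Fin m → ℝ) :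
    ∏ p ∈ Finset.univ.filter (fun p : Fin m × Fin m => p.1 < p.2), f p.1 p.2
      = pairProd Finset.univ f := by
  simp only [pairProd, Finset.prod_filter, ← Finset.univ_product_univ, Finset.prod_product]

lemma pairProd_mul (s : Finset (Fin m)) (f g : Fin m → Fin m → ℝ) :
    pairProd s (fun i k => f i k * g i k) = pairProd s f * pairProd s g := by
  simp only [pairProd, Finset.prod_mul_distrib]

lemma gammaSchur_comp_perm (Q : Fin m → ℝ) (σ : Equiv.Perm (Fin m)) :
    gammaSchur (Q ∘ σ) = (Equiv.Perm.sign σ : ℤ) * gammaSchur Q := by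
  have h := Equiv.Perm.prod_Ioi_comp_eq_sign_mul_prod σ (f := fun i j => schurKer (Q i) (Q j))
    fun i j => schurKer_antisymm _ _
  simp only [gammaSchur, pairProd_univ, Function.comp_apply]
  rw [h, Equiv.prod_comp σ fun i => Real.Gamma (Q i)]
  ring

lemma pairProd_sub_eq_sum_perm (v : Fin m → ℝ) :
    pairProd Finset.univ (fun i k => v i - v k)
      = pairProd Finset.univ (fun _ _ : Fin m => (-1 : ℝ))
        * ∑ σ : Equiv.Perm (Fin m), (Equiv.Perm.sign σ : ℤ) * ∏ i, v i ^ (σ i : ℕ) := by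
  have h := Matrix.det_vandermonde v
  rw [← Matrix.det_transpose, Matrix.det_apply'] at h
  simp only [Matrix.transpose_apply, Matrix.vandermonde_apply] at h
  rw [h, ← pairProd_univ fun i j => v j - v i, ← pairProd_mul]
  simp

lemma ae_restrict_orthant_pos (m : ℕ) : ∀ᵐ x ∂volume.restrict (orthant m), ∀ i, 0 < x i := by
  rw [ae_restrict_iff' (measurableSet_orthant m)]
  have h : ∀ᵐ x : Fin m → ℝ, ∀ i, x i ≠ 0 :=
    ae_all_iff.2 fun i => by
      rw [ae_iff]
      simpa [← volume_pi] using Measure.pi_hyperplane (fun _ : Fin m => (volume : Measure ℝ)) i 0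
  filter_upwards [h] with x hx hx0 i using (hx0 i).lt_of_ne (hx i).symm

lemma integrableOn_pairProd_schurKer_mul {Q : Fin m → ℝ} (hQ : ∀ i, 0 < Q i) :
    IntegrableOn (fun x => pairProd Finset.univ (fun i k => schurKer (x i) (x k))
        * ∏ i, (x i ^ (Q i - 1) * Real.exp (-x i))) (orthant m) := by
  have := isProbabilityMeasure_gammaPi hQ
  have h1 : IntegrableOn (fun x => ∏ i, (x i ^ (Q i - 1) * Real.exp (-x i))) (orthant m) := by
    refine not_imp_comm.1 integral_undef (ne_of_gt ?_)
    have h := integral_orthant_eq_gammaPi hQ fun _ => 1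
    simp only [one_mul, integral_const, probReal_univ, smul_eq_mul, mul_one] at h
    rw [h]
    exact Finset.prod_pos fun i _ => Real.Gamma_pos_of_pos (hQ i)
  refine h1.bdd_mul (c := 1) (measurable_pairProd_schurKer _).aestronglyMeasurable ?_
  filter_upwards [ae_restrict_orthant_pos m] with x hx
  exact abs_pairProd_schurKer_le_one _ hx

variable {θ a : ℝ}

/-- The Gamma shape parameters of the monomials in the interpolating weight. -/
def shape (m : ℕ) (θ a : ℝ) (i : Fin m) : ℝ := a + 1 + θ * (i : ℕ)

lemma shape_pos (hθ : 0 < θ) (ha : -1 < a) (i : Fin m) : 0 < shape m θ a i := by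
  unfold shape
  have : 0 ≤ θ * ((i : ℕ) : ℝ) := by positivity
  linarith

lemma Vdens_mul_eq_sum_perm {x : Fin m → ℝ} (hx : ∀ i, 0 < x i) (b : Fin m → ℝ) :
    (∏ i, x i ^ b i) * Vdens m θ a x * Real.exp (-∑ i, x i)
      = pairProd Finset.univ (fun _ _ : Fin m => (-1 : ℝ))
        * ∑ σ : Equiv.Perm (Fin m), (Equiv.Perm.sign σ : ℤ)
          * (pairProd Finset.univ (fun i k => schurKer (x i) (x k))
            * ∏ i, (x i ^ (shape m θ a (σ i) + b i - 1) * Real.exp (-x i))) := by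
  have hmono : ∀ σ : Equiv.Perm (Fin m),
      ∏ i, (x i ^ (shape m θ a (σ i) + b i - 1) * Real.exp (-x i))
        = (∏ i, x i ^ b i) * (∏ i, x i ^ a) * (∏ i, (x i ^ θ) ^ (σ i : ℕ))
          * Real.exp (-∑ i, x i) := by
    intro σ
    rw [← Finset.sum_neg_distrib, Real.exp_sum, ← Finset.prod_mul_distrib,
      ← Finset.prod_mul_distrib, ← Finset.prod_mul_distrib]
    refine Finset.prod_congr rfl fun i _ => ?_
    rw [← Real.rpow_natCast, ← Real.rpow_mul (hx i).le, ← Real.rpow_add (hx i),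
      ← Real.rpow_add (hx i), shape]
    congr 2
    ring
  have hV : Vdens m θ a x = pairProd Finset.univ (fun i k => schurKer (x i) (x k))
      * pairProd Finset.univ (fun i k => x i ^ θ - x k ^ θ) * ∏ i, x i ^ a := by
    rw [← pairProd_mul, ← prod_lt_pairs_eq_pairProd]
    rfl
  rw [hV, pairProd_sub_eq_sum_perm fun i => x i ^ θ]
  simp only [hmono, Finset.mul_sum, Finset.sum_mul]
  refine Finset.sum_congr rfl fun σ _ => ?_
  ring

lemma gammaSchur_shape_perm_add (σ : Equiv.Perm (Fin m)) (b : Fin m → ℝ) :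
    gammaSchur (fun i => shape m θ a (σ i) + b i)
      = (Equiv.Perm.sign σ : ℤ) * gammaSchur (fun i => shape m θ a i + b (σ.symm i)) := by
  rw [← gammaSchur_comp_perm]
  congr 1
  funext i
  simp

lemma integrableOn_rpow_mul_Vdens (hθ : 0 < θ) (ha : -1 < a) {b : Fin m → ℝ} (hb : ∀ i, 0 ≤ b i) :
    IntegrableOn (fun x => (∏ i, x i ^ b i) * Vdens m θ a x * Real.exp (-∑ i, x i))
      (orthant m) := by
  have hQ : ∀ (σ : Equiv.Perm (Fin m)) i, 0 < shape m θ a (σ i) + b i := fun σ i =>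
    add_pos_of_pos_of_nonneg (shape_pos hθ ha _) (hb i)
  refine Integrable.congr ?_
    ((ae_restrict_orthant_pos m).mono fun x hx => (Vdens_mul_eq_sum_perm hx b).symm)
  exact (integrable_finsetSum _ fun σ _ =>
    (integrableOn_pairProd_schurKer_mul (hQ σ)).const_mul _).const_mul _

lemma integral_rpow_mul_Vdens (hθ : 0 < θ) (ha : -1 < a) {b : Fin m → ℝ} (hb : ∀ i, 0 ≤ b i) :
    ∫ x in orthant m, (∏ i, x i ^ b i) * Vdens m θ a x * Real.exp (-∑ i, x i)
      = pairProd Finset.univ (fun _ _ : Fin m => (-1 : ℝ))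
        * ∑ σ : Equiv.Perm (Fin m), gammaSchur (fun i => shape m θ a i + b (σ.symm i)) := by
  have hQ : ∀ (σ : Equiv.Perm (Fin m)) i, 0 < shape m θ a (σ i) + b i := fun σ i =>
    add_pos_of_pos_of_nonneg (shape_pos hθ ha _) (hb i)
  rw [integral_congr_ae
      ((ae_restrict_orthant_pos m).mono fun x hx => Vdens_mul_eq_sum_perm hx b),
    integral_const_mul, integral_finsetSum _ fun σ _ =>
      (integrableOn_pairProd_schurKer_mul (hQ σ)).const_mul _]
  congr 1
  refine Finset.sum_congr rfl fun σ _ => ?_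
  rw [integral_const_mul, integral_orthant_pairProd_schurKer (hQ σ)]
  have h := gammaSchur_shape_perm_add (θ := θ) (a := a) σ b
  have hs : ((Equiv.Perm.sign σ : ℤ) : ℝ) * (Equiv.Perm.sign σ : ℤ) = 1 := by
    exact_mod_cast Int.units_coe_mul_self _
  calc _ = ((Equiv.Perm.sign σ : ℤ) : ℝ) * gammaSchur (fun i => shape m θ a (σ i) + b i) := rfl
    _ = _ := by rw [h, ← mul_assoc, hs, one_mul]

lemma integral_Vdens_mul_exp (hθ : 0 < θ) (ha : -1 < a) :
    ∫ x in orthant m, Vdens m θ a x * Real.exp (-∑ i, x i)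
      = pairProd Finset.univ (fun _ _ : Fin m => (-1 : ℝ))
        * (m.factorial * gammaSchur (shape m θ a)) := by
  have h := integral_rpow_mul_Vdens (m := m) hθ ha (b := 0) fun _ => le_rfl
  simp only [Pi.zero_apply, Real.rpow_zero, Finset.prod_const_one, one_mul, add_zero,
    Finset.sum_const, Finset.card_univ, Fintype.card_perm, Fintype.card_fin, nsmul_eq_mul] at h
  exact h

lemma prod_rpow_single_two (x : Fin m → ℝ) (l : Fin m) :
    ∏ i, x i ^ (Pi.single l 2 : Fin m → ℝ) i = x l ^ 2 := by
  rw [Finset.prod_eq_single l]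
  · simp
  · intro i _ hi
    simp [hi]
  · simp

lemma integral_sum_sq_mul_Vdens_mul_exp (hθ : 0 < θ) (ha : -1 < a) :
    ∫ x in orthant m, (∑ i, x i ^ 2) * Vdens m θ a x * Real.exp (-∑ i, x i)
      = pairProd Finset.univ (fun _ _ : Fin m => (-1 : ℝ))
        * (m.factorial
          * ∑ k, gammaSchur (fun i => shape m θ a i + (Pi.single k 2 : Fin m → ℝ) i)) := by
  have hb : ∀ l i, 0 ≤ (Pi.single l 2 : Fin m → ℝ) i := fun l i => by
    rw [Pi.single_apply]
    split_ifs <;> norm_num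
  have hI := fun l => integrableOn_rpow_mul_Vdens hθ ha (hb l)
  have hV := fun l => integral_rpow_mul_Vdens hθ ha (hb l)
  simp only [prod_rpow_single_two] at hI hV
  simp only [Finset.sum_mul]
  rw [integral_finsetSum _ fun l _ => hI l, Finset.sum_congr rfl fun l _ => hV l,
    ← Finset.mul_sum, Finset.sum_comm]
  have hσ : ∀ σ : Equiv.Perm (Fin m),
      ∑ l, gammaSchur (fun i => shape m θ a i + (Pi.single l 2 : Fin m → ℝ) (σ.symm i))
        = ∑ k, gammaSchur (fun i => shape m θ a i + (Pi.single k 2 : Fin m → ℝ) i) := by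
    intro σ
    rw [← Equiv.sum_comp σ fun k =>
      gammaSchur (fun i => shape m θ a i + (Pi.single k 2 : Fin m → ℝ) i)]
    refine Finset.sum_congr rfl fun l _ => ?_
    congr 1
    funext i
    simp only [Pi.single_apply, Equiv.symm_apply_eq]
  simp [hσ, Fintype.card_perm]

end Antisymmetrization

section GammaQuotients

lemma prod_range_add_eq_Gamma_div {z : ℝ} {m : ℕ} (hz : 0 < z + m) :
    ∏ j ∈ Finset.range m, (z + j) = Real.Gamma (z + m) / Real.Gamma z := by
  by_cases h : ∃ j ∈ Finset.range m, z + (j : ℝ) = 0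
  · obtain ⟨j, hj, hj0⟩ := h
    rw [Finset.prod_eq_zero hj hj0, eq_neg_of_add_eq_zero_left hj0, Real.Gamma_neg_nat_eq_zero,
      div_zero]
  · push Not at h
    have hG : Real.Gamma z ≠ 0 := Real.Gamma_ne_zero fun n hn => by
      refine h n (Finset.mem_range.2 ?_) (by rw [hn]; ring)
      rw [hn] at hz
      exact_mod_cast (by linarith : (n : ℝ) < m)
    rw [eq_div_iff hG]
    clear hz
    induction m with
    | zero => simp
    | succ m ih =>
      rw [Finset.prod_range_succ, mul_right_comm,
        ih fun j hj => h j (Finset.mem_range.2 (by have := Finset.mem_range.1 hj; omega)), mul_comm,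
        ← Real.Gamma_add_one (h m (Finset.self_mem_range_succ m))]
      push_cast
      ring_nf

lemma prod_range_sub_eq_Gamma_div {z : ℝ} {m : ℕ} (hz : 0 < z + 1) :
    ∏ j ∈ Finset.range m, (z - j) = Real.Gamma (z + 1) / Real.Gamma (z + 1 - m) := by
  have h := prod_range_add_eq_Gamma_div (z := z + 1 - m) (m := m) (by linarith)
  rw [sub_add_cancel] at h
  rw [← h, ← Finset.prod_range_reflect]
  refine Finset.prod_congr rfl fun j hj => ?_
  have := Finset.mem_range.1 hj
  rw [Nat.cast_sub (by omega), Nat.cast_sub (by omega)]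
  push_cast
  ring

lemma prod_erase_sub_eq_factorial {m : ℕ} (k : Fin m) :
    ∏ j ∈ Finset.univ.erase k, (((k : ℕ) : ℝ) - (j : ℕ))
      = (-1) ^ ((k : ℕ) + m - 1) * ((k : ℕ).factorial * (m - 1 - k).factorial) := by
  obtain ⟨k, hk⟩ := k
  obtain ⟨r, rfl⟩ := Nat.exists_eq_add_of_le (Nat.succ_le_of_lt hk)
  have h1 : ∏ j ∈ Finset.univ.erase (⟨k, hk⟩ : Fin (k.succ + r)), ((k : ℝ) - (j : ℕ))
      = ∏ j ∈ Finset.range (k + 1 + r), if j = k then 1 else ((k : ℝ) - (j : ℕ)) := by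
    rw [← Fin.prod_univ_eq_prod_range fun j => if j = k then 1 else ((k : ℝ) - (j : ℕ)),
      ← Finset.mul_prod_erase _ _ (Finset.mem_univ (⟨k, hk⟩ : Fin (k.succ + r)))]
    simp only [if_true, one_mul]
    refine Finset.prod_congr rfl fun j hj => ?_
    rw [if_neg fun h => Finset.ne_of_mem_erase hj (Fin.ext h)]
  have h2 : ∏ j ∈ Finset.range k, (if j = k then 1 else ((k : ℝ) - (j : ℕ))) = k.factorial := by
    rw [← Finset.prod_range_add_one_eq_factorial, ← Finset.prod_range_reflect]
    push_cast
    refine Finset.prod_congr rfl fun j hj => ?_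
    have := Finset.mem_range.1 hj
    rw [if_neg (by omega), Nat.cast_sub (by omega), Nat.cast_sub (by omega)]
    push_cast
    ring
  have h3 : ∏ j ∈ Finset.range r, (if k + 1 + j = k then 1 else ((k : ℝ) - (k + 1 + j : ℕ)))
      = (-1) ^ r * r.factorial := by
    rw [← Finset.prod_range_add_one_eq_factorial]
    push_cast
    rw [← Finset.card_range r, ← Finset.prod_const, Finset.card_range, ← Finset.prod_mul_distrib]
    refine Finset.prod_congr rfl fun j hj => ?_
    rw [if_neg (by omega)]
    ring
  simp only
  rw [h1, Finset.prod_range_add, Finset.prod_range_succ, h2, h3, if_pos rfl,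
    show k + (k.succ + r) - 1 = 2 * k + r by omega, show k.succ + r - 1 - k = r by omega, pow_add,
    pow_mul, neg_one_sq, one_pow]
  ring

end GammaQuotients

section PurityTerms

variable {m : ℕ}

lemma gammaSchur_ne_zero {Q : Fin m → ℝ} (hQ : ∀ i, 0 < Q i) (hinj : Function.Injective Q) :
    gammaSchur Q ≠ 0 := by
  refine mul_ne_zero (Finset.prod_ne_zero_iff.2 fun i _ => (Real.Gamma_pos_of_pos (hQ i)).ne') ?_
  refine Finset.prod_ne_zero_iff.2 fun i _ => Finset.prod_ne_zero_iff.2 fun j hj => ?_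
  exact div_ne_zero (sub_ne_zero.2 fun h => (Finset.mem_filter.1 hj).2.ne (hinj h))
    (add_pos (hQ i) (hQ j)).ne'

lemma gammaSchur_eq_erase (Q : Fin m → ℝ) (k : Fin m) :
    gammaSchur Q = Real.Gamma (Q k) * (∏ j ∈ Finset.univ.erase k, schurKer (Q k) (Q j))
      * ((∏ j ∈ Finset.univ.erase k, if k < j then 1 else -1)
        * (∏ j ∈ Finset.univ.erase k, Real.Gamma (Q j))
        * pairProd (Finset.univ.erase k) fun i j => schurKer (Q i) (Q j)) := by
  have h : ∏ j ∈ Finset.univ.erase k, (if k < j then schurKer (Q k) (Q j) else schurKer (Q j) (Q k))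
      = (∏ j ∈ Finset.univ.erase k, schurKer (Q k) (Q j))
        * ∏ j ∈ Finset.univ.erase k, if k < j then 1 else -1 := by
    rw [← Finset.prod_mul_distrib]
    refine Finset.prod_congr rfl fun j _ => ?_
    split_ifs
    · rw [mul_one]
    · rw [schurKer_antisymm, mul_neg_one]
  rw [gammaSchur, pairProd_eq_erase (Finset.mem_univ k), h,
    ← Finset.mul_prod_erase _ _ (Finset.mem_univ k)]
  ring

lemma gammaSchur_add_single {Q : Fin m → ℝ} (hQ : ∀ i, 0 < Q i) (k : Fin m) :
    gammaSchur (fun i => Q i + (Pi.single k 2 : Fin m → ℝ) i)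
        * ∏ j ∈ Finset.univ.erase k, schurKer (Q k) (Q j)
      = gammaSchur Q * (Q k * (Q k + 1) * ∏ j ∈ Finset.univ.erase k, schurKer (Q k + 2) (Q j)) := by
  have hj : ∀ j ∈ Finset.univ.erase k, Q j + (Pi.single k 2 : Fin m → ℝ) j = Q j := by
    intro j hj
    simp [Finset.ne_of_mem_erase hj]
  have hpair : pairProd (Finset.univ.erase k) (fun i j => schurKer
      (Q i + (Pi.single k 2 : Fin m → ℝ) i) (Q j + (Pi.single k 2 : Fin m → ℝ) j))
      = pairProd (Finset.univ.erase k) fun i j => schurKer (Q i) (Q j) := by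
    unfold pairProd
    refine Finset.prod_congr rfl fun i hi => Finset.prod_congr rfl fun j hj' => ?_
    simp only [hj i hi, hj j (Finset.mem_filter.1 hj').1]
  have hG : Real.Gamma (Q k + 2) = (Q k + 1) * (Q k * Real.Gamma (Q k)) := by
    rw [← Real.Gamma_add_one (hQ k).ne', ← Real.Gamma_add_one (by linarith [hQ k])]
    ring_nf
  rw [gammaSchur_eq_erase _ k, gammaSchur_eq_erase Q k, hpair,
    Finset.prod_congr rfl fun j hj' => by rw [hj j hj'],
    Finset.prod_congr (f := fun j => Real.Gamma (Q j + (Pi.single k 2 : Fin m → ℝ) j)) rfl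
      fun j hj' => by rw [hj j hj'],
    Pi.single_eq_same, hG]
  ring

variable {θ a : ℝ}

lemma shape_injective (hθ : 0 < θ) : Function.Injective (shape m θ a) := by
  intro i j h
  have : ((i : ℕ) : ℝ) = (j : ℕ) := by
    apply mul_left_cancel₀ hθ.ne'
    unfold shape at h
    linarith
  exact Fin.ext (by exact_mod_cast this)

lemma gammaSchur_shape_add_single_div (hθ : 0 < θ) (ha : -1 < a) (k : Fin m) :
    gammaSchur (fun i => shape m θ a i + (Pi.single k 2 : Fin m → ℝ) i)
        / gammaSchur (shape m θ a)
      = (-1 : ℝ) ^ ((k : ℕ) + m - 1) * θ * (θ * (k : ℕ) + a + 2) ^ 2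
          * (Real.Gamma ((k : ℕ) + 2 * (a + 2) / θ)
              * Real.Gamma ((k : ℕ) + m + 2 * (a + 1) / θ)
              * Real.Gamma ((k : ℕ) + 1 + 2 / θ)
            / (Real.Gamma ((k : ℕ) + 2 * (a + 1) / θ)
                * Real.Gamma ((k : ℕ) + m + 2 * (a + 2) / θ)
                * Real.Gamma ((k : ℕ) + 1 + 2 / θ - m)))
          / (2 * (m - 1 - k).factorial * (k : ℕ).factorial) := by
  have hpos := shape_pos (m := m) hθ ha
  have hinj := shape_injective (m := m) (a := a) hθ
  have hθ0 := hθ.ne'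
  set p := shape m θ a k with hp
  have hp0 : 0 < p := hpos k
  have hk0 : (0 : ℝ) ≤ (k : ℕ) := Nat.cast_nonneg _
  have ha1 : 0 < 2 * (a + 1) / θ := div_pos (by linarith) hθ
  have ha2 : 0 < 2 * (a + 2) / θ := div_pos (by linarith) hθ
  have hm0 : (0 : ℝ) ≤ m := Nat.cast_nonneg _
  have hscale : ∀ (f : Fin m → ℝ) (g : ℕ → ℝ), (∀ j, f j = θ * g j) →
      ∏ j, f j = θ ^ m * ∏ j ∈ Finset.range m, g j := by
    intro f g hfg
    rw [Finset.prod_congr rfl fun j _ => hfg j, Finset.prod_mul_distrib, Finset.prod_const,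
      Finset.card_univ, Fintype.card_fin, Fin.prod_univ_eq_prod_range]
  have hA2 : 2 * ∏ j ∈ Finset.univ.erase k, (p + 2 - shape m θ a j)
      = θ ^ m * (Real.Gamma ((k : ℕ) + 1 + 2 / θ) / Real.Gamma ((k : ℕ) + 1 + 2 / θ - m)) := by
    have h := Finset.mul_prod_erase Finset.univ (fun j => p + 2 - shape m θ a j)
      (Finset.mem_univ k)
    rw [hscale _ (fun j => (k : ℕ) + 2 / θ - j) fun j => by
      rw [hp]
      unfold shape
      field_simp
      ring, prod_range_sub_eq_Gamma_div (by positivity)] at h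
    rw [← hp, add_sub_cancel_left] at h
    rw [h, add_right_comm]
  have hB1 : 2 * p * ∏ j ∈ Finset.univ.erase k, (p + shape m θ a j)
      = θ ^ m * (Real.Gamma ((k : ℕ) + m + 2 * (a + 1) / θ)
        / Real.Gamma ((k : ℕ) + 2 * (a + 1) / θ)) := by
    have h := Finset.mul_prod_erase Finset.univ (fun j => p + shape m θ a j) (Finset.mem_univ k)
    rw [hscale _ (fun j => (k : ℕ) + 2 * (a + 1) / θ + j) fun j => by
      rw [hp]
      unfold shape
      field_simp
      ring, prod_range_add_eq_Gamma_div (by positivity)] at h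
    rw [← hp, ← two_mul] at h
    rw [h, add_right_comm]
  have hB2 : (2 * p + 2) * ∏ j ∈ Finset.univ.erase k, (p + 2 + shape m θ a j)
      = θ ^ m * (Real.Gamma ((k : ℕ) + m + 2 * (a + 2) / θ)
        / Real.Gamma ((k : ℕ) + 2 * (a + 2) / θ)) := by
    have h := Finset.mul_prod_erase Finset.univ (fun j => p + 2 + shape m θ a j)
      (Finset.mem_univ k)
    rw [hscale _ (fun j => (k : ℕ) + 2 * (a + 2) / θ + j) fun j => by
      rw [hp]
      unfold shape
      field_simp
      ring, prod_range_add_eq_Gamma_div (by positivity)] at h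
    rw [← hp, show p + 2 + p = 2 * p + 2 by ring] at h
    rw [h, add_right_comm]
  have hA1 : θ * ∏ j ∈ Finset.univ.erase k, (p - shape m θ a j)
      = θ ^ m * ((-1) ^ ((k : ℕ) + m - 1) * ((k : ℕ).factorial * (m - 1 - k).factorial)) := by
    rw [← prod_erase_sub_eq_factorial, Finset.prod_congr rfl fun j _ =>
      show p - shape m θ a j = θ * ((k : ℕ) - (j : ℕ)) by rw [hp]; unfold shape; ring,
      Finset.prod_mul_distrib, Finset.prod_const, Finset.card_erase_of_mem (Finset.mem_univ k),
      Finset.card_univ, Fintype.card_fin, ← mul_assoc, ← pow_succ',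
      Nat.sub_add_cancel (Nat.one_le_of_lt k.isLt)]
  have hratio := gammaSchur_add_single hpos k
  rw [← hp] at hratio
  unfold schurKer at hratio
  rw [Finset.prod_div_distrib, Finset.prod_div_distrib] at hratio
  have hPhi := gammaSchur_ne_zero hpos hinj
  have hnA1 : ∏ j ∈ Finset.univ.erase k, (p - shape m θ a j) ≠ 0 :=
    Finset.prod_ne_zero_iff.2 fun j hj =>
      sub_ne_zero.2 fun h => Finset.ne_of_mem_erase hj (hinj h).symm
  have hnB1 : ∏ j ∈ Finset.univ.erase k, (p + shape m θ a j) ≠ 0 :=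
    Finset.prod_ne_zero_iff.2 fun j _ => (add_pos hp0 (hpos j)).ne'
  have hnB2 : ∏ j ∈ Finset.univ.erase k, (p + 2 + shape m θ a j) ≠ 0 :=
    Finset.prod_ne_zero_iff.2 fun j _ => (add_pos (by linarith) (hpos j)).ne'
  have hT : θ ^ m ≠ 0 := pow_ne_zero m hθ0
  have hG1 : Real.Gamma ((k : ℕ) + m + 2 * (a + 2) / θ) ≠ 0 :=
    (Real.Gamma_pos_of_pos (by positivity)).ne'
  have hG2 : Real.Gamma ((k : ℕ) + 2 * (a + 2) / θ) ≠ 0 :=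
    (Real.Gamma_pos_of_pos (by positivity)).ne'
  have hsq : ((-1 : ℝ) ^ ((k : ℕ) + m - 1)) * (-1) ^ ((k : ℕ) + m - 1) = 1 := by
    rw [← mul_pow]
    simp
  have hs0 : ((-1 : ℝ) ^ ((k : ℕ) + m - 1)) ≠ 0 := left_ne_zero_of_mul_eq_one hsq
  have hf1 : ((k : ℕ).factorial : ℝ) ≠ 0 := Nat.cast_ne_zero.2 (Nat.factorial_ne_zero _)
  have hf2 : ((m - 1 - k).factorial : ℝ) ≠ 0 := Nat.cast_ne_zero.2 (Nat.factorial_ne_zero _)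
  have hpk : θ * (k : ℕ) + a + 2 = p + 1 := by
    rw [hp]
    unfold shape
    ring
  have hG3 : Real.Gamma ((k : ℕ) + 2 * (a + 1) / θ) ≠ 0 :=
    (Real.Gamma_pos_of_pos (by positivity)).ne'
  have hp1 : p + 1 ≠ 0 := by positivity
  have hmain : gammaSchur (fun i => shape m θ a i + (Pi.single k 2 : Fin m → ℝ) i)
      / gammaSchur (shape m θ a)
      = p * (p + 1) * (∏ j ∈ Finset.univ.erase k, (p + 2 - shape m θ a j))
        * (∏ j ∈ Finset.univ.erase k, (p + shape m θ a j))
        / ((∏ j ∈ Finset.univ.erase k, (p - shape m θ a j))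
          * ∏ j ∈ Finset.univ.erase k, (p + 2 + shape m θ a j)) := by
    field_simp at hratio ⊢
    linear_combination hratio
  rw [hmain, eq_div_of_mul_eq two_ne_zero ((mul_comm _ _).trans hA2),
    eq_div_of_mul_eq (by positivity) ((mul_comm _ _).trans hB1),
    eq_div_of_mul_eq (by positivity) ((mul_comm _ _).trans hB2),
    eq_div_of_mul_eq hθ0 ((mul_comm _ _).trans hA1), hpk]
  have hp2 : 2 * p + 2 ≠ 0 := by positivity
  clear hA1 hA2 hB1 hB2 hmain hratio
  generalize (-1 : ℝ) ^ ((k : ℕ) + m - 1) = s at hsq hs0 ⊢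
  generalize Real.Gamma ((k : ℕ) + m + 2 * (a + 2) / θ) = G1 at hG1 ⊢
  generalize Real.Gamma ((k : ℕ) + 2 * (a + 2) / θ) = G2 at hG2 ⊢
  generalize Real.Gamma ((k : ℕ) + 2 * (a + 1) / θ) = G3 at hG3 ⊢
  generalize Real.Gamma ((k : ℕ) + 1 + 2 / θ - m) = G4
  generalize Real.Gamma ((k : ℕ) + 1 + 2 / θ) = G5
  generalize Real.Gamma ((k : ℕ) + m + 2 * (a + 1) / θ) = G6
  rcases eq_or_ne G4 0 with rfl | hg
  · simp
  · field_simp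
    linear_combination (-(G5 * G6)) * hsq

end PurityTerms

section Simplex

variable {θ a : ℝ}

lemma measurable_Vdens (m : ℕ) (θ a : ℝ) : Measurable (Vdens m θ a) := by
  unfold Vdens
  refine Measurable.mul (Finset.measurable_fun_prod _ fun p _ => ?_)
    (Finset.measurable_fun_prod _ fun i _ => ?_) <;> fun_prop

lemma Vdens_nonneg {m : ℕ} (hθ : 0 < θ) {x : Fin m → ℝ} (hx : x ∈ orthant m) :
    0 ≤ Vdens m θ a x := by
  refine mul_nonneg (Finset.prod_nonneg fun p _ => ?_)
    (Finset.prod_nonneg fun i _ => Real.rpow_nonneg (hx i) a)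
  have h1 := hx p.1
  have h2 := hx p.2
  rcases le_total (x p.1) (x p.2) with h | h
  · exact mul_nonneg_of_nonpos_of_nonpos
      (div_nonpos_of_nonpos_of_nonneg (sub_nonpos.2 h) (add_nonneg h1 h2))
      (sub_nonpos.2 (Real.rpow_le_rpow h1 h hθ.le))
  · exact mul_nonneg (div_nonneg (sub_nonneg.2 h) (add_nonneg h1 h2))
      (sub_nonneg.2 (Real.rpow_le_rpow h2 h hθ.le))

lemma card_lt_pairs (m : ℕ) :
    (#(Finset.univ.filter fun p : Fin m × Fin m => p.1 < p.2) : ℝ) = m * (m - 1) / 2 := by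
  have h : #(Finset.univ.filter fun p : Fin m × Fin m => p.1 < p.2)
      = ∑ i ∈ Finset.range m, i := by
    rw [Finset.card_filter, ← Finset.univ_product_univ, Finset.sum_product_right,
      ← Fin.sum_univ_eq_sum_range fun i => i]
    refine Finset.sum_congr rfl fun j _ => ?_
    rw [← Finset.card_filter, ← Fin.card_Iio j]
    congr 1
    ext i
    simp
  rw [h, eq_div_iff two_ne_zero]
  have h2 := Finset.sum_range_id_mul_two m
  rcases m with _ | m
  · simp
  · have h3 : ((∑ i ∈ Finset.range (m + 1), i : ℕ) : ℝ) * 2 = ((m + 1 : ℕ) : ℝ) * (m : ℝ) := by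
      exact_mod_cast h2
    rw [h3]
    push_cast
    ring

lemma Vdens_smul {m : ℕ} {r : ℝ} (hr : 0 < r) {x : Fin m → ℝ} (hx : x ∈ orthant m) :
    Vdens m θ a (r • x) = r ^ (dPar m θ a - m) * Vdens m θ a x := by
  unfold Vdens
  have h1 : ∀ p : Fin m × Fin m, ((r • x) p.1 - (r • x) p.2) / ((r • x) p.1 + (r • x) p.2)
      * ((r • x) p.1 ^ θ - (r • x) p.2 ^ θ)
      = r ^ θ * ((x p.1 - x p.2) / (x p.1 + x p.2) * (x p.1 ^ θ - x p.2 ^ θ)) := by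
    intro p
    simp only [Pi.smul_apply, smul_eq_mul]
    rw [Real.mul_rpow hr.le (hx _), Real.mul_rpow hr.le (hx _), ← mul_add, ← mul_sub,
      mul_div_mul_left _ _ hr.ne']
    ring
  have h2 : ∀ i, (r • x) i ^ a = r ^ a * x i ^ a := fun i => by
    rw [Pi.smul_apply, smul_eq_mul, Real.mul_rpow hr.le (hx _)]
  simp only [h1, h2, Finset.prod_mul_distrib, Finset.prod_const, Finset.card_univ,
    Fintype.card_fin]
  rw [← Real.rpow_natCast, ← Real.rpow_natCast, ← Real.rpow_mul hr.le, ← Real.rpow_mul hr.le,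
    card_lt_pairs, show dPar m θ a - m = θ * (m * (m - 1) / 2) + a * m by unfold dPar; ring,
    Real.rpow_add hr]
  ring

lemma dPar_pos {m : ℕ} (hm : 1 ≤ m) (hθ : 0 < θ) (ha : -1 < a) : 0 < dPar m θ a := by
  have h1 : (1 : ℝ) ≤ m := by exact_mod_cast hm
  have h2 : 0 ≤ (m - 1) * θ := mul_nonneg (by linarith) hθ.le
  unfold dPar
  have : 0 < (m : ℝ) * θ - θ + 2 * a + 2 := by linarith
  positivity

lemma Ef_sum_sq_eq {m : ℕ} (hm : 1 ≤ m) (hθ : 0 < θ) (ha : -1 < a) :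
    Ef m θ a (fun lam => ∑ i, lam i ^ 2)
      = (∫ x in orthant m, (∑ i, x i ^ 2) * Vdens m θ a x * Real.exp (-∑ i, x i))
        / (∫ x in orthant m, Vdens m θ a x * Real.exp (-∑ i, x i))
        / (dPar m θ a * (dPar m θ a + 1)) := by
  have hd := dPar_pos hm hθ ha
  obtain ⟨n, rfl⟩ : ∃ n, m = n + 1 := ⟨m - 1, by omega⟩
  have hV := measurable_Vdens (n + 1) θ a
  have hD := integral_orthant_homogeneous n (Vdens (n + 1) θ a) hV
    (fun x hx => Vdens_nonneg hθ hx) (δ := dPar (n + 1) θ a - (n + 1 : ℕ))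
    (by push_cast; linarith) fun r hr x hx => Vdens_smul hr hx
  have hN := integral_orthant_homogeneous n (fun x => (∑ i, x i ^ 2) * Vdens (n + 1) θ a x)
    (by fun_prop)
    (fun x hx => mul_nonneg (Finset.sum_nonneg fun i _ => sq_nonneg _) (Vdens_nonneg hθ hx))
    (δ := dPar (n + 1) θ a - (n + 1 : ℕ) + 2) (by push_cast; linarith) fun r hr x hx => by
      rw [Vdens_smul hr hx, Real.rpow_add hr, Real.rpow_two]
      simp only [Pi.smul_apply, smul_eq_mul, mul_pow, ← Finset.mul_sum]
      ring
  rw [hD, hN, show dPar (n + 1) θ a - (n + 1 : ℕ) + n + 1 = dPar (n + 1) θ a by push_cast; ring,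
    show dPar (n + 1) θ a - (n + 1 : ℕ) + 2 + n + 1 = dPar (n + 1) θ a + 1 + 1 by push_cast; ring,
    Real.Gamma_add_one (by linarith), Real.Gamma_add_one hd.ne', Ef]
  have hG := (Real.Gamma_pos_of_pos hd).ne'
  have hd1 : dPar (n + 1) θ a + 1 ≠ 0 := by linarith
  have hd0 := hd.ne'
  generalize Real.Gamma (dPar (n + 1) θ a) = G at hG ⊢
  generalize dPar (n + 1) θ a = d at hd1 hd0 ⊢
  field_simp
  rfl

end Simplex

/-- **Proposition 1: mean quantum purity of the quantum interpolating ensemble.**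
For every integer `m ≥ 1` and reals `θ > 0`, `a > −1`, with
`d = m(mθ−θ+2a+2)/2` and
`A_θ(k) = Γ(k+2(a+2)/θ) Γ(k+m+2(a+1)/θ) Γ(k+1+2/θ)
          / (Γ(k+2(a+1)/θ) Γ(k+m+2(a+2)/θ) Γ(k+1+2/θ−m))`
(the reciprocal of a Gamma factor at a nonpositive integer is interpreted as `0`,
the value `Real.Gamma` takes there):
`E_f[Σ λ_i²] = Σ_{k=0}^{m−1} (−1)^{k+m−1} θ (θk+a+2)² A_θ(k)
                / (2 d (d+1) (m−1−k)! k!)`. -/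
theorem mean_purity_interpolating (m : ℕ) (hm : 1 ≤ m) (θ a : ℝ)
    (hθ : 0 < θ) (ha : -1 < a) :
    Ef m θ a (fun lam => ∑ i, lam i ^ 2)
      = ∑ k ∈ Finset.range m,
          (-1 : ℝ) ^ (k + m - 1) * θ * (θ * k + a + 2) ^ 2
            * (Real.Gamma ((k : ℝ) + 2 * (a + 2) / θ)
                * Real.Gamma ((k : ℝ) + m + 2 * (a + 1) / θ)
                * Real.Gamma ((k : ℝ) + 1 + 2 / θ)
              / (Real.Gamma ((k : ℝ) + 2 * (a + 1) / θ)
                  * Real.Gamma ((k : ℝ) + m + 2 * (a + 2) / θ)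
                  * Real.Gamma ((k : ℝ) + 1 + 2 / θ - m)))
            / (2 * dPar m θ a * (dPar m θ a + 1)
                * (Nat.factorial (m - 1 - k)) * (Nat.factorial k)) := by
  rw [Ef_sum_sq_eq hm hθ ha, integral_Vdens_mul_exp hθ ha,
    integral_sum_sq_mul_Vdens_mul_exp hθ ha]
  have hε : pairProd Finset.univ (fun _ _ : Fin m => (-1 : ℝ)) ≠ 0 :=
    Finset.prod_ne_zero_iff.2 fun _ _ => Finset.prod_ne_zero_iff.2 fun _ _ => by norm_num
  rw [mul_div_mul_left _ _ hε, mul_div_mul_left _ _ (Nat.cast_ne_zero.2 m.factorial_ne_zero),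
    Finset.sum_div, Finset.sum_div, Finset.sum_range]
  refine Finset.sum_congr rfl fun k _ => ?_
  rw [gammaSchur_shape_add_single_div hθ ha k, div_div]
  congr 1
  ring

end
end

section
/- Fix a real a > −1. For every integer j ≥ 1 and every real x, the θ = 2 biorthogonal polynomials satisfy the five-term recurrence x²( a₂ p_{j+2}(x²) + a₁ p_{j+1}(x²) + a₀ p_j(x²) ) = r₃ p_{j+3}(x²) + r₂ p_{j+2}(x²) + r₁ p_{j+1}(x²) + r₀ p_j(x²) + r₋₁ p_{j−1}(x²), where a₂ = (2aj+3a+2j²+6j+5)/(a+2j+4), a₁ = −2(a+2j+3)(2aj+3a+2j²+6j+5)/((a+2j+2)(a+2j+4)), a₀ = (2aj+3a+2j²+6j+5)/(a+2j+2), r₃ = (j+3)(a+j+3)(2aj+3a+2j²+6j+5)/(a+2j+4), r₂ = (2aj+3a+2j²+6j+5)(a³+6a²j+12a²+12aj²+46aj+41a+8j³+46j²+82j+42)/((a+2j+2)(a+2j+4)), r₁ = (a+2j+3)(2aj+3a+2j²+6j+5)(2a²+6aj+9a+6j²+18j+10)/((a+2j+2)(a+2j+4)), r₀ = (2aj+3a+2j²+6j+5)(a³+6a²j+6a²+12aj²+26aj+11a+8j³+26j²+22j+6)/((a+2j+2)(a+2j+4)),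 and r₋₁ = j(a+j)(2aj+3a+2j²+6j+5)/(a+2j+2). -/
open Finset

/-- The `θ = 2` biorthogonal polynomial of the quantum interpolating ensemble,
evaluated at `x²`:
`p_j(x²) = Σ_{k=0}^{j} √2 (−1)^{k+j} Γ(k+j+a+1) x^{2k}
            / (Γ(2k+a+1) Γ(k+a+1) (j−k)! k!)`. -/
noncomputable def pTwo (a : ℝ) (j : ℕ) (x : ℝ) : ℝ :=
  ∑ k ∈ Finset.range (j + 1),
    Real.sqrt 2 * (-1 : ℝ) ^ (k + j) * Real.Gamma ((k : ℝ) + j + a + 1) * x ^ (2 * k)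
      / (Real.Gamma (2 * (k : ℝ) + a + 1) * Real.Gamma ((k : ℝ) + a + 1)
          * (Nat.factorial (j - k)) * (Nat.factorial k))

theorem cast_descFactorial_succ (d i : ℕ) :
    ((d.descFactorial (i + 1) : ℕ) : ℝ) = ((d : ℝ) - i) * (d.descFactorial i : ℝ) := by
  rw [Nat.descFactorial_succ, Nat.cast_mul]
  rcases le_or_gt i d with h | h
  · rw [Nat.cast_sub h]
  · simp [Nat.descFactorial_of_lt h]

theorem one_div_factorial_sub {k n N : ℕ} (hkn : k ≤ n) (hn : n ≤ N) :
    (1 : ℝ) / (n - k).factorial = ((N - k).descFactorial (N - n) : ℝ) / (N - k).factorial := by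
  have h := Nat.factorial_mul_descFactorial (n := N - k) (k := N - n) (by omega)
  rw [show N - k - (N - n) = n - k by omega] at h
  rw [div_eq_div_iff (by positivity) (by positivity), ← h]
  push_cast
  ring

/-- The common weight of the `x ^ (2 * k)` coefficients of all `pTwo a n x`, `n ≤ N`. -/
noncomputable def pTwoWeight (a x : ℝ) (N k : ℕ) : ℝ :=
  Real.sqrt 2 * x ^ (2 * k) /
    (Real.Gamma (2 * (k : ℝ) + a + 1) * Real.Gamma ((k : ℝ) + a + 1) * k.factorial
      * (N - k).factorial)

theorem pTwo_eq_sum_range (a x : ℝ) {n N : ℕ} (hn : n ≤ N) :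
    pTwo a n x = ∑ k ∈ Finset.range (N + 1), pTwoWeight a x N k *
      ((-1 : ℝ) ^ (k + n) * Real.Gamma ((k : ℝ) + n + a + 1)
        * ((N - k).descFactorial (N - n) : ℝ)) := by
  rw [← Finset.sum_subset (Finset.range_mono (Nat.succ_le_succ hn))]
  · refine Finset.sum_congr rfl fun k hk => ?_
    have h := one_div_factorial_sub (Nat.lt_succ_iff.mp (Finset.mem_range.mp hk)) hn
    calc _ = Real.sqrt 2 * (-1 : ℝ) ^ (k + n) * Real.Gamma ((k : ℝ) + n + a + 1) * x ^ (2 * k)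
          / (Real.Gamma (2 * (k : ℝ) + a + 1) * Real.Gamma ((k : ℝ) + a + 1) * k.factorial)
          * (1 / (n - k).factorial) := by rw [div_mul_div_comm, mul_one]; congr 1; ring
      _ = _ := by rw [h, pTwoWeight, div_mul_div_comm, div_mul_eq_mul_div]; congr 1; ring
  · intro k hk hk'
    simp only [Finset.mem_range] at hk hk'
    rw [Nat.descFactorial_of_lt (by omega)]
    simp

theorem sq_mul_pTwoWeight {a : ℝ} (ha : -1 < a) (x : ℝ) (N k : ℕ) :
    x ^ 2 * pTwoWeight a x N k = pTwoWeight a x (N + 1) (k + 1) *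
      ((k + 1) * (k + 1 + a) * (2 * (k + 1) + a) * (2 * (k + 1) + a - 1)) := by
  have hk : (0 : ℝ) ≤ k := k.cast_nonneg
  have h₁ : Real.Gamma ((k : ℝ) + 1 + a + 1) = (k + 1 + a) * Real.Gamma (k + a + 1) := by
    rw [Real.Gamma_add_one (by linarith), add_right_comm]
  have h₂ : Real.Gamma (2 * ((k : ℝ) + 1) + a + 1)
      = (2 * (k + 1) + a) * ((2 * (k + 1) + a - 1) * Real.Gamma (2 * k + a + 1)) := by
    rw [Real.Gamma_add_one (by linarith),
      show 2 * ((k : ℝ) + 1) + a = (2 * (k + 1) + a - 1) + 1 by ring,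
      Real.Gamma_add_one (by linarith)]
    ring_nf
  have h₃ : Real.Gamma ((k : ℝ) + a + 1) ≠ 0 := (Real.Gamma_pos_of_pos (by linarith)).ne'
  have h₄ : Real.Gamma (2 * (k : ℝ) + a + 1) ≠ 0 := (Real.Gamma_pos_of_pos (by linarith)).ne'
  have h₅ : (k : ℝ) + 1 + a ≠ 0 := by linarith
  have h₆ : 2 * ((k : ℝ) + 1) + a ≠ 0 := by linarith
  have h₇ : 2 * ((k : ℝ) + 1) + a - 1 ≠ 0 := by linarith
  have h₈ : (k : ℝ) + 1 ≠ 0 := by linarith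
  rw [pTwoWeight, pTwoWeight, Nat.add_sub_add_right, Nat.factorial_succ]
  push_cast
  rw [h₁, h₂]
  field_simp
  ring

theorem sq_mul_pTwo_eq_sum_range {a : ℝ} (ha : -1 < a) (x : ℝ) {n N : ℕ} (hn : n ≤ N) :
    x ^ 2 * pTwo a n x = ∑ k ∈ Finset.range (N + 2), pTwoWeight a x (N + 1) k *
      (k * (k + a) * (2 * k + a) * (2 * k + a - 1)
        * ((-1 : ℝ) ^ (k + n + 1) * Real.Gamma ((k : ℝ) + n + a)
        * ((N + 1 - k).descFactorial (N - n) : ℝ))) := by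
  rw [pTwo_eq_sum_range a x hn, Finset.sum_range_succ' _ (N + 1), Finset.mul_sum]
  simp only [Nat.cast_zero, zero_mul, mul_zero, add_zero]
  refine Finset.sum_congr rfl fun k _ => ?_
  rw [← mul_assoc, sq_mul_pTwoWeight ha, Nat.add_sub_add_right,
    show k + 1 + n + 1 = k + n + 2 by ring, pow_add (-1 : ℝ) (k + n) 2]
  push_cast
  rw [show (k : ℝ) + 1 + n + a = k + n + a + 1 by ring]
  ring

/-- **Five-term recurrence for the `θ = 2` biorthogonal polynomials.**
For every real `a > −1`, integer `j ≥ 1` and real `x`: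
`x²(a₂ p_{j+2}(x²) + a₁ p_{j+1}(x²) + a₀ p_j(x²))
  = r₃ p_{j+3}(x²) + r₂ p_{j+2}(x²) + r₁ p_{j+1}(x²) + r₀ p_j(x²) + r₋₁ p_{j−1}(x²)`
with the explicit coefficients stated below. -/
theorem five_term_recurrence (a : ℝ) (ha : -1 < a) (j : ℕ) (hj : 1 ≤ j) (x : ℝ) :
    x ^ 2 *
        ((2 * a * j + 3 * a + 2 * (j : ℝ) ^ 2 + 6 * j + 5) / (a + 2 * j + 4)
            * pTwo a (j + 2) x
          + (-(2 * (a + 2 * (j : ℝ) + 3)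
                * (2 * a * j + 3 * a + 2 * (j : ℝ) ^ 2 + 6 * j + 5))
              / ((a + 2 * j + 2) * (a + 2 * j + 4))) * pTwo a (j + 1) x
          + (2 * a * j + 3 * a + 2 * (j : ℝ) ^ 2 + 6 * j + 5) / (a + 2 * j + 2)
              * pTwo a j x)
      = ((j : ℝ) + 3) * (a + j + 3)
            * (2 * a * j + 3 * a + 2 * (j : ℝ) ^ 2 + 6 * j + 5) / (a + 2 * j + 4)
            * pTwo a (j + 3) x
        + (2 * a * j + 3 * a + 2 * (j : ℝ) ^ 2 + 6 * j + 5)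
            * (a ^ 3 + 6 * a ^ 2 * j + 12 * a ^ 2 + 12 * a * (j : ℝ) ^ 2 + 46 * a * j
                + 41 * a + 8 * (j : ℝ) ^ 3 + 46 * (j : ℝ) ^ 2 + 82 * j + 42)
            / ((a + 2 * j + 2) * (a + 2 * j + 4)) * pTwo a (j + 2) x
        + (a + 2 * (j : ℝ) + 3) * (2 * a * j + 3 * a + 2 * (j : ℝ) ^ 2 + 6 * j + 5)
            * (2 * a ^ 2 + 6 * a * j + 9 * a + 6 * (j : ℝ) ^ 2 + 18 * j + 10)
            / ((a + 2 * j + 2) * (a + 2 * j + 4)) * pTwo a (j + 1) x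
        + (2 * a * j + 3 * a + 2 * (j : ℝ) ^ 2 + 6 * j + 5)
            * (a ^ 3 + 6 * a ^ 2 * j + 6 * a ^ 2 + 12 * a * (j : ℝ) ^ 2 + 26 * a * j
                + 11 * a + 8 * (j : ℝ) ^ 3 + 26 * (j : ℝ) ^ 2 + 22 * j + 6)
            / ((a + 2 * j + 2) * (a + 2 * j + 4)) * pTwo a j x
        + (j : ℝ) * (a + j) * (2 * a * j + 3 * a + 2 * (j : ℝ) ^ 2 + 6 * j + 5)
            / (a + 2 * j + 2) * pTwo a (j - 1) x := by
  obtain ⟨m, rfl⟩ : ∃ m, j = m + 1 := ⟨j - 1, by omega⟩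
  have hm : (0 : ℝ) ≤ m := m.cast_nonneg
  rw [Nat.add_sub_cancel]
  simp only [add_assoc m, Nat.reduceAdd]
  rw [mul_add, mul_add, mul_left_comm (x ^ 2), mul_left_comm (x ^ 2), mul_left_comm (x ^ 2),
    sq_mul_pTwo_eq_sum_range ha x (show m + 3 ≤ m + 3 by omega),
    sq_mul_pTwo_eq_sum_range ha x (show m + 2 ≤ m + 3 by omega),
    sq_mul_pTwo_eq_sum_range ha x (show m + 1 ≤ m + 3 by omega),
    pTwo_eq_sum_range a x (show m + 4 ≤ m + 4 by omega),
    pTwo_eq_sum_range a x (show m + 3 ≤ m + 4 by omega),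
    pTwo_eq_sum_range a x (show m + 2 ≤ m + 4 by omega),
    pTwo_eq_sum_range a x (show m + 1 ≤ m + 4 by omega),
    pTwo_eq_sum_range a x (show m ≤ m + 4 by omega)]
  simp only [Finset.mul_sum, ← Finset.sum_add_distrib]
  refine Finset.sum_congr (by rfl) fun k hk => ?_
  obtain ⟨d, hd⟩ : ∃ d, m + 4 = k + d := ⟨m + 4 - k, by have := Finset.mem_range.mp hk; omega⟩
  have hd' : (d : ℝ) = m + 4 - k := by
    rw [eq_sub_iff_add_eq']
    exact_mod_cast hd.symm
  have hk0 : (0 : ℝ) ≤ k := k.cast_nonneg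
  have g₁ : Real.Gamma ((k : ℝ) + m + a + 2) = (k + m + a + 1) * Real.Gamma (k + m + a + 1) := by
    rw [← Real.Gamma_add_one (by linarith)]; ring_nf
  have g₂ : Real.Gamma ((k : ℝ) + m + a + 3) = (k + m + a + 2) * Real.Gamma (k + m + a + 2) := by
    rw [← Real.Gamma_add_one (by linarith)]; ring_nf
  have g₃ : Real.Gamma ((k : ℝ) + m + a + 4) = (k + m + a + 3) * Real.Gamma (k + m + a + 3) := by
    rw [← Real.Gamma_add_one (by linarith)]; ring_nf
  have g₄ : Real.Gamma ((k : ℝ) + m + a + 5) = (k + m + a + 4) * Real.Gamma (k + m + a + 4) := by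
    rw [← Real.Gamma_add_one (by linarith)]; ring_nf
  have hD : a + 2 * (m + 1) + 2 ≠ 0 := by linarith
  have hE : a + 2 * (m + 1) + 4 ≠ 0 := by linarith
  simp only [add_assoc m, Nat.reduceAdd, show m + 4 - k = d by omega, Nat.add_sub_cancel_left,
    Nat.add_sub_add_left, Nat.reduceSub, Nat.sub_self]
  push_cast
  rw [show (k : ℝ) + (m + 3) + a = k + m + a + 3 by ring,
    show (k : ℝ) + (m + 2) + a = k + m + a + 2 by ring,
    show (k : ℝ) + (m + 1) + a = k + m + a + 1 by ring,
    show (k : ℝ) + (m + 4) + a + 1 = k + m + a + 5 by ring,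
    show (k : ℝ) + m + a + 3 + 1 = k + m + a + 4 by ring,
    show (k : ℝ) + m + a + 2 + 1 = k + m + a + 3 by ring,
    show (k : ℝ) + m + a + 1 + 1 = k + m + a + 2 by ring, g₄, g₃, g₂, g₁]
  have e₁ := cast_descFactorial_succ d 0
  have e₂ := cast_descFactorial_succ d 1
  have e₃ := cast_descFactorial_succ d 2
  have e₄ := cast_descFactorial_succ d 3
  simp only [Nat.reduceAdd, Nat.descFactorial_zero] at e₁ e₂ e₃ e₄
  simp only [Nat.descFactorial_zero, e₄, e₃, e₂, e₁, hd', ← add_assoc, pow_add]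
  push_cast
  field_simp
  ring
end

section
/- For every integer m ≥ 1, all reals θ > 0, a > −1, and all x, y > 0, the symmetrized kernel factorizes as K₀₀(x,y) + K₀₀(y,x) = w(x)·w(y). -/
open Finset MeasureTheory Set

noncomputable section

/-- The parameter `α = 2(a+1)/θ − 1`. -/
def alp (θ a : ℝ) : ℝ := 2 * (a + 1) / θ - 1

/-- The upper incomplete Gamma function `Γ(s,x) = ∫_x^∞ t^{s−1} e^{−t} dt`. -/
def uGamma (s x : ℝ) : ℝ := ∫ t in Ioi x, t ^ (s - 1) * Real.exp (-t)

/-- The biorthogonal polynomial `p_j(x^θ)` of the quantum interpolating ensemble. -/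
def pPoly (θ a : ℝ) (j : ℕ) (x : ℝ) : ℝ :=
  ∑ k ∈ Finset.range (j + 1),
    Real.sqrt 2 * (-1 : ℝ) ^ (k + j) * Real.Gamma ((k : ℝ) + j + alp θ a + 1)
        * x ^ (θ * k)
      / (Real.Gamma (θ * k + a + 1) * Real.Gamma ((k : ℝ) + alp θ a + 1)
          * (Nat.factorial (j - k)) * (Nat.factorial k))

/-- The dual biorthogonal polynomial `q_j(y^θ)` of the quantum interpolating ensemble. -/
def qPoly (θ a : ℝ) (j : ℕ) (y : ℝ) : ℝ :=
  ∑ k ∈ Finset.range (j + 1),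
    Real.sqrt 2 * (-1 : ℝ) ^ (k + j) * (θ * j + a + 1)
        * Real.Gamma ((k : ℝ) + j + alp θ a + 1) * y ^ (θ * k)
      / (Real.Gamma (θ * k + a + 2) * Real.Gamma ((k : ℝ) + alp θ a + 1)
          * (Nat.factorial (j - k)) * (Nat.factorial k))

/-- The kernel `K₀₀(x,y) = Σ_{k=0}^{m−1} p_k(x^θ) q_k(y^θ)`. -/
def K00 (m : ℕ) (θ a : ℝ) (x y : ℝ) : ℝ :=
  ∑ k ∈ Finset.range m, pPoly θ a k x * qPoly θ a k y

/-- The factor `w(x)`. -/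
def wFun (m : ℕ) (θ a : ℝ) (x : ℝ) : ℝ :=
  θ * ∑ k ∈ Finset.range m,
    (-1 : ℝ) ^ k * Real.Gamma ((k : ℝ) + alp θ a + m + 1) * x ^ (θ * k)
      / (Real.Gamma (θ * k + a + 2) * Real.Gamma ((k : ℝ) + alp θ a + 1)
          * (Nat.factorial (m - 1 - k)) * (Nat.factorial k))

/-- The factor `v(x)`. -/
def vFun (m : ℕ) (θ a : ℝ) (x : ℝ) : ℝ :=
  Real.exp (-x) * x ^ a
    - θ * x ^ (2 * a + 1) * ∑ k ∈ Finset.range m,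
        (-1 : ℝ) ^ k * Real.Gamma ((k : ℝ) + alp θ a + m + 1)
            * uGamma (-(θ * k) - a) x * x ^ (θ * k)
          / ((θ * k + a + 1) * Real.Gamma ((k : ℝ) + alp θ a + 1)
              * (Nat.factorial (m - 1 - k)) * (Nat.factorial k))

/-- The kernel `K₀₁(x,y) = x^a e^{−x} ∫_0^∞ v^{a+1} e^{−v} K₀₀(y,v)/(x+v) dv`. -/
def K01 (m : ℕ) (θ a : ℝ) (x y : ℝ) : ℝ :=
  x ^ a * Real.exp (-x)
    * ∫ v in Ioi (0 : ℝ), v ^ (a + 1) * Real.exp (-v) * K00 m θ a y v / (x + v)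

/-- The kernel `K₁₀(x,y) = y^{a+1} e^{−y} ∫_0^∞ u^a e^{−u} K₀₀(u,x)/(y+u) du`. -/
def K10 (m : ℕ) (θ a : ℝ) (x y : ℝ) : ℝ :=
  y ^ (a + 1) * Real.exp (-y)
    * ∫ u in Ioi (0 : ℝ), u ^ a * Real.exp (-u) * K00 m θ a u x / (y + u)

/-- The Cauchy–Laguerre weight `W(x,y) = x^a y^{a+1} e^{−x−y}/(x+y)`. -/
def Wwt (a : ℝ) (x y : ℝ) : ℝ := x ^ a * y ^ (a + 1) * Real.exp (-x - y) / (x + y)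

/-- The kernel `K₁₁(x,y)`. -/
def K11 (m : ℕ) (θ a : ℝ) (x y : ℝ) : ℝ :=
  x ^ a * y ^ (a + 1) * Real.exp (-x - y)
      * ∫ v in Ioi (0 : ℝ), ∫ u in Ioi (0 : ℝ),
          (v ^ a * Real.exp (-v) / (y + v)) * (u ^ (a + 1) * Real.exp (-u) / (x + u))
            * K00 m θ a v u
    - Wwt a x y

/-- The `k`-th term from which the sums `p_j`, `q_j`, `w_j` and `w_{j+1}` are all built, up to factors
linear in `k`. -/
def kernelTerm (θ a : ℝ) (j : ℕ) (x : ℝ) (k : ℕ) : ℝ :=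
  (-1 : ℝ) ^ k * Real.Gamma ((k : ℝ) + j + alp θ a + 1) * x ^ (θ * k)
    / (Real.Gamma (θ * k + a + 2) * Real.Gamma ((k : ℝ) + alp θ a + 1)
        * (Nat.factorial (j - k)) * (Nat.factorial k))

lemma theta_mul_alp_add_one {θ a : ℝ} (hθ : 0 < θ) : θ * (alp θ a + 1) = 2 * (a + 1) := by
  unfold alp
  field_simp
  ring

lemma alp_add_one_pos {θ a : ℝ} (hθ : 0 < θ) (ha : -1 < a) : 0 < alp θ a + 1 := by
  have h : 0 < a + 1 := by linarith
  have : alp θ a + 1 = 2 * (a + 1) / θ := by unfold alp; ring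
  rw [this]
  positivity

lemma pPoly_eq_sum_kernelTerm {θ a : ℝ} (hθ : 0 < θ) (ha : -1 < a) (j : ℕ) (x : ℝ) :
    pPoly θ a j x = Real.sqrt 2 * (-1) ^ j *
      (θ * ∑ k ∈ Finset.range (j + 1), k * kernelTerm θ a j x k
        + (a + 1) * ∑ k ∈ Finset.range (j + 1), kernelTerm θ a j x k) := by
  simp only [pPoly, Finset.mul_sum, ← Finset.sum_add_distrib]
  refine Finset.sum_congr rfl fun k _ => ?_
  have hpos : 0 < θ * k + a + 1 := by
    have : 0 ≤ θ * k := by positivity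
    linarith
  have hΓ : Real.Gamma (θ * k + a + 2) = (θ * k + a + 1) * Real.Gamma (θ * k + a + 1) := by
    rw [← Real.Gamma_add_one hpos.ne']
    ring_nf
  rw [kernelTerm, hΓ, pow_add, ← mul_assoc θ, ← add_mul, ← add_assoc,
    ← mul_div_assoc, ← mul_div_assoc, ← mul_div_mul_left _ _ hpos.ne']
  congr 1 <;> ring

lemma qPoly_eq_sum_kernelTerm (θ a : ℝ) (j : ℕ) (x : ℝ) :
    qPoly θ a j x = Real.sqrt 2 * (-1) ^ j * (θ * j + a + 1) *
      ∑ k ∈ Finset.range (j + 1), kernelTerm θ a j x k := by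
  simp only [qPoly, Finset.mul_sum]
  refine Finset.sum_congr rfl fun k _ => ?_
  rw [kernelTerm, pow_add]
  ring

lemma wFun_succ_eq_sum_kernelTerm {θ a : ℝ} (hθ : 0 < θ) (ha : -1 < a) (j : ℕ) (x : ℝ) :
    wFun (j + 1) θ a x = θ *
      (∑ k ∈ Finset.range (j + 1), k * kernelTerm θ a j x k
        + (j + (alp θ a + 1)) * ∑ k ∈ Finset.range (j + 1), kernelTerm θ a j x k) := by
  simp only [wFun, Finset.mul_sum, ← Finset.sum_add_distrib]
  refine Finset.sum_congr rfl fun k _ => ?_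
  have hpos : 0 < (k : ℝ) + j + alp θ a + 1 := by
    linarith [alp_add_one_pos hθ ha, (Nat.cast_nonneg k : (0 : ℝ) ≤ k),
      (Nat.cast_nonneg j : (0 : ℝ) ≤ j)]
  have hΓ : Real.Gamma ((k : ℝ) + alp θ a + (j + 1 : ℕ) + 1)
      = (k + j + alp θ a + 1) * Real.Gamma (k + j + alp θ a + 1) := by
    rw [← Real.Gamma_add_one hpos.ne']
    push_cast
    ring_nf
  rw [kernelTerm, hΓ, Nat.add_sub_cancel]
  ring

lemma wFun_eq_sum_kernelTerm (θ a : ℝ) (j : ℕ) (x : ℝ) :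
    wFun j θ a x = θ *
      (j * ∑ k ∈ Finset.range (j + 1), kernelTerm θ a j x k
        - ∑ k ∈ Finset.range (j + 1), k * kernelTerm θ a j x k) := by
  rw [wFun, Finset.mul_sum (Finset.range (j + 1)), ← Finset.sum_sub_distrib,
    Finset.sum_range_succ, sub_self, add_zero]
  congr 1
  refine Finset.sum_congr rfl fun k hk => ?_
  obtain ⟨n, rfl⟩ : ∃ n, j = k + n + 1 :=
    ⟨j - k - 1, by have := Finset.mem_range.mp hk; omega⟩
  have e1 : k + n + 1 - 1 - k = n := by omega
  have e2 : k + n + 1 - k = n + 1 := by omega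
  have e3 : (k : ℝ) + alp θ a + (k + n + 1 : ℕ) + 1 = k + (k + n + 1 : ℕ) + alp θ a + 1 := by
    ring
  rw [kernelTerm, e1, e2, e3, Nat.factorial_succ]
  push_cast
  have hn : (n : ℝ) + 1 ≠ 0 := by positivity
  rw [← sub_mul, show (k : ℝ) + n + 1 - k = n + 1 by ring, ← mul_div_assoc,
    ← mul_div_mul_left _ _ hn]
  congr 1
  ring

/-- Telescoping: the `j`-th symmetrized summand is an increment of `w(x) w(y)`. -/
lemma pPoly_mul_qPoly_add_swap {θ a : ℝ} (hθ : 0 < θ) (ha : -1 < a) (j : ℕ) (x y : ℝ) :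
    pPoly θ a j x * qPoly θ a j y + pPoly θ a j y * qPoly θ a j x
      = wFun (j + 1) θ a x * wFun (j + 1) θ a y - wFun j θ a x * wFun j θ a y := by
  rw [wFun_eq_sum_kernelTerm θ a j x, wFun_eq_sum_kernelTerm θ a j y,
    wFun_succ_eq_sum_kernelTerm hθ ha, wFun_succ_eq_sum_kernelTerm hθ ha,
    pPoly_eq_sum_kernelTerm hθ ha, pPoly_eq_sum_kernelTerm hθ ha,
    qPoly_eq_sum_kernelTerm, qPoly_eq_sum_kernelTerm]
  generalize ∑ k ∈ Finset.range (j + 1), kernelTerm θ a j x k = S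
  generalize ∑ k ∈ Finset.range (j + 1), kernelTerm θ a j y k = S'
  generalize ∑ k ∈ Finset.range (j + 1), (k : ℝ) * kernelTerm θ a j x k = T
  generalize ∑ k ∈ Finset.range (j + 1), (k : ℝ) * kernelTerm θ a j y k = T'
  have hs : a = θ * (alp θ a + 1) / 2 - 1 := by linarith [theta_mul_alp_add_one (a := a) hθ]
  generalize alp θ a = α at hs
  subst hs
  have h2 : Real.sqrt 2 ^ 2 = 2 := Real.sq_sqrt (by norm_num)
  have h1 : ((-1 : ℝ) ^ j) ^ 2 = 1 := by rw [← pow_mul, mul_comm, pow_mul]; simp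
  generalize Real.sqrt 2 = r at h2
  generalize (-1 : ℝ) ^ j = e at h1
  have hre : (r * e) ^ 2 = 2 := by rw [mul_pow, h2, h1, mul_one]
  linear_combination (θ * j + θ * (α + 1) / 2) *
    ((θ * T + θ * (α + 1) / 2 * S) * S' + (θ * T' + θ * (α + 1) / 2 * S') * S) * hre

/-- **Kernel factorization (i).** For every integer `m ≥ 1`, reals `θ > 0`,
`a > −1`, and all `x, y > 0`: `K₀₀(x,y) + K₀₀(y,x) = w(x)·w(y)`. -/
theorem K00_factorization (m : ℕ) (hm : 1 ≤ m) (θ a : ℝ) (hθ : 0 < θ) (ha : -1 < a)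
    (x y : ℝ) (hx : 0 < x) (hy : 0 < y) :
    K00 m θ a x y + K00 m θ a y x = wFun m θ a x * wFun m θ a y := by
  simp only [K00, ← Finset.sum_add_distrib, pPoly_mul_qPoly_add_swap hθ ha]
  rw [Finset.sum_range_sub fun j => wFun j θ a x * wFun j θ a y]
  simp [wFun]

end
end
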